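/- arXiv:1810.00311 — 2 statements merged into one kernel-verified Lean document; each statement's English description precedes it below -/
import Mathlib

section
/- Suppose the operator G is strictly irreducible on every bounded domain of ℝ^d and condition (C1) holds with respect to some bounded domain times M, and let ν̃ be an invariant probability measure of (X(t),Λ(t)). Then for every bounded domain D ⊂ ℝ^d and every l ∈ M, ν̃(D × {l}) > 0. -/
open MeasureTheory Set Filter Metric Matrix
open scoped NNReal ENNReal Topology

noncomputable section

/-- Euclidean state space `ℝ^d`. -/
abbrev Rd (d : ℕ) : Type := EuclideanSpace ℝ (Fin d)

/-- The generator `G` of the regime-switching jump diffusion: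
`Gf(x,i) = ½ Σ a_{kl} ∂²f/∂x_k∂x_l + Σ b_k ∂f/∂x_k
  + ∫ [f(x+z,i) − f(x,i) − ∇f(x,i)·z 1_{|z|<1}] π_i(x,dz) + Σ_j q_{ij}(x) f(x,j)`. -/
def gen {d m : ℕ} (a : Rd d → Fin m → Matrix (Fin d) (Fin d) ℝ)
    (b : Rd d → Fin m → Rd d)
    (π : Rd d → Fin m → Measure (Rd d))
    (q : Rd d → Fin m → Fin m → ℝ)
    (f : Rd d → Fin m → ℝ) (x : Rd d) (i : Fin m) : ℝ :=
  (1 / 2) * ∑ k, ∑ l, a x i k l *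
      iteratedFDeriv ℝ 2 (fun y => f y i) x
        ![EuclideanSpace.single k (1 : ℝ), EuclideanSpace.single l (1 : ℝ)]
    + ∑ k, b x i k * fderiv ℝ (fun y => f y i) x (EuclideanSpace.single k (1 : ℝ))
    + ∫ z, (f (x + z) i - f x i -
        (if ‖z‖ < 1 then fderiv ℝ (fun y => f y i) x z else 0)) ∂(π x i)
    + ∑ j, q x i j * f x j

/-- First hitting time (valued in `ℝ≥0∞`) of a set `U` by the process `Z`:
`σ_U = inf{t ≥ 0 : Z(t) ∈ U}`. -/
def hit {Ω α : Type*} (Z : ℝ≥0 → Ω → α) (U : Set α) (ω : Ω) : ℝ≥0∞ :=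
  ⨅ (t : ℝ≥0) (_ : Z t ω ∈ U), (t : ℝ≥0∞)

/-- A bounded domain of `ℝ^d`: a nonempty connected bounded open set. -/
def BddDomain {d : ℕ} (D : Set (Rd d)) : Prop :=
  IsOpen D ∧ IsConnected D ∧ Bornology.IsBounded D

/-- A regime-switching jump diffusion `(X(t), Λ(t))` on `ℝ^d × {1,…,m}` with coefficients
`b, σ`, switching rates `q`, jump density `π̃` (fields `b, sig, q, pit`), satisfying
assumptions (A1)–(A4), together with its family of laws `(P_{x,i})`, which solves the
martingale problem for `(G, C_b²(ℝ^d))`. -/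
structure SJD (d m : ℕ) (Ω : Type) [mΩ : MeasurableSpace Ω] : Type 1 where
  /-- the filtration -/
  ℱ : Filtration ℝ≥0 mΩ
  /-- the continuous component -/
  X : ℝ≥0 → Ω → Rd d
  /-- the switching component -/
  Λ : ℝ≥0 → Ω → Fin m
  /-- the laws `P_{x,i}` -/
  P : Rd d → Fin m → Measure Ω
  prob : ∀ x i, IsProbabilityMeasure (P x i)
  /-- drift -/
  b : Rd d → Fin m → Rd d
  /-- diffusion matrix -/
  sig : Rd d → Fin m → Matrix (Fin d) (Fin d) ℝ
  /-- switching rates -/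
  q : Rd d → Fin m → Fin m → ℝ
  /-- jump intensity density `π̃_i(x,z)` -/
  pit : Rd d → Fin m → Rd d → ℝ
  -- (A1)
  sig_cont : ∀ i, Continuous fun x => sig x i
  b_cont : ∀ i, Continuous fun x => b x i
  growth : ∃ c > (0 : ℝ), ∀ x i,
    (∑ k, ∑ l, |sig x i k l|) + ∑ k, |b x i k| ≤ c * (1 + ‖x‖)
  q_meas : ∀ i j, Measurable fun x => q x i j
  q_bdd : ∀ i j, ∃ C : ℝ, ∀ x, |q x i j| ≤ C
  q_nonneg : ∀ x i j, i ≠ j → 0 ≤ q x i j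
  q_rowsum : ∀ x i, ∑ j, q x i j = 0
  -- (A2): local uniform ellipticity of `a = σσᵀ`
  ellipticity : ∀ D : Set (Rd d), Bornology.IsBounded D →
    ∃ κ₀ ∈ Set.Ioc (0 : ℝ) 1, ∀ x ∈ D, ∀ (i) (ξ : Rd d),
      κ₀ * ‖ξ‖ ^ 2 ≤ ∑ k, ∑ l, ξ k * (sig x i * (sig x i)ᵀ) k l * ξ l ∧
      ∑ k, ∑ l, ξ k * (sig x i * (sig x i)ᵀ) k l * ξ l ≤ κ₀⁻¹ * ‖ξ‖ ^ 2
  -- (A3)/(A4): properties of the jump measure `π_i(x,dz) = π̃_i(x,z) dz`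
  pit_nonneg : ∀ x i z, 0 ≤ pit x i z
  pit_meas : ∀ i, Measurable fun p : Rd d × Rd d => pit p.1 i p.2
  levy_integrable : ∀ x i,
    (∫⁻ z, ENNReal.ofReal (min 1 (‖z‖ ^ 2)) ∂
      (volume.withDensity fun z => ENNReal.ofReal (pit x i z))) < ⊤
  bigjump_bdd : ∃ C : ℝ≥0∞, C < ⊤ ∧ ∀ x i,
    (volume.withDensity fun z => ENNReal.ofReal (pit x i z)) ((Metric.ball (0 : Rd d) 1)ᶜ) ≤ C
  smalljump : ∃ c > (0 : ℝ), ∀ x i,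
    (∫⁻ z in Metric.ball (0 : Rd d) 1, ENNReal.ofReal (‖z‖ ^ 2) ∂
      (volume.withDensity fun z => ENNReal.ofReal (pit x i z)))
      ≤ ENNReal.ofReal (c * (1 + ‖x‖ ^ 2))
  domination : ∀ n : ℕ, 1 ≤ n → ∃ Pin : Measure (Rd d), SigmaFinite Pin ∧
    (∫⁻ z, ENNReal.ofReal (min 1 (‖z‖ ^ 2)) ∂Pin) < ⊤ ∧
    ∀ x ∈ Metric.ball (0 : Rd d) n, ∀ i,
      (volume.withDensity fun z => ENNReal.ofReal (pit x i z)) ≤ Pin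
  comparability : ∃ κ₂ > (0 : ℝ), ∃ β > (0 : ℝ), ∀ r ∈ Set.Ioo (0 : ℝ) 1, ∃ αr : ℝ,
    1 < αr ∧ αr < κ₂ * r ^ (-β) ∧
    ∀ (x₀ x y z : Rd d) (i), x ∈ Metric.ball x₀ (r / 2) → y ∈ Metric.ball x₀ (r / 2) →
      z ∉ Metric.ball x₀ r → pit x i (z - x) ≤ αr * pit y i (z - y)
  -- the process: càdlàg, adapted, with initial condition, solving the martingale problem
  adapted : Adapted ℱ fun t ω => (X t ω, Λ t ω)
  cadlag_right : ∀ ω (t : ℝ≥0),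
    ContinuousWithinAt (fun s => (X s ω, Λ s ω)) (Set.Ici t) t
  cadlag_left : ∀ ω (t : ℝ≥0), 0 < t →
    ∃ L : Rd d × Fin m, Tendsto (fun s => (X s ω, Λ s ω)) (𝓝[<] t) (𝓝 L)
  init : ∀ x i, P x i {ω | X 0 ω = x ∧ Λ 0 ω = i} = 1
  martingale_problem : ∀ f : Rd d → Fin m → ℝ,
    (∀ i, ContDiff ℝ 2 fun y => f y i) →
    (∀ i, ∃ C : ℝ, ∀ x, |f x i| ≤ C ∧ ‖fderiv ℝ (fun y => f y i) x‖ ≤ C ∧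
        ‖iteratedFDeriv ℝ 2 (fun y => f y i) x‖ ≤ C) →
    ∀ x i, Martingale
      (fun t ω => f (X t ω) (Λ t ω) - f x i -
        ∫ u in Set.Ioc (0 : ℝ) (t : ℝ),
          gen (fun y j => sig y j * (sig y j)ᵀ) b
            (fun y j => volume.withDensity fun z => ENNReal.ofReal (pit y j z)) q f
            (X u.toNNReal ω) (Λ u.toNNReal ω))
      ℱ (P x i)

namespace SJD

variable {d m : ℕ} {Ω : Type} [MeasurableSpace Ω]

/-- the diffusion matrix `a = σ σᵀ` -/
def a (s : SJD d m Ω) (x : Rd d) (i : Fin m) : Matrix (Fin d) (Fin d) ℝ :=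
  s.sig x i * (s.sig x i)ᵀ

/-- the jump measure `π_i(x, dz) = π̃_i(x,z) dz` -/
def π (s : SJD d m Ω) (x : Rd d) (i : Fin m) : Measure (Rd d) :=
  volume.withDensity fun z => ENNReal.ofReal (s.pit x i z)

/-- the two-component process `Z = (X, Λ)` -/
def Z (s : SJD d m Ω) (t : ℝ≥0) (ω : Ω) : Rd d × Fin m := (s.X t ω, s.Λ t ω)

/-- the generator applied with the coefficients of `s` -/
def G (s : SJD d m Ω) (f : Rd d → Fin m → ℝ) (x : Rd d) (i : Fin m) : ℝ :=
  gen s.a s.b s.π s.q f x i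

/-- first entrance time `σ_A = inf{t ≥ 0 : X(t) ∈ A}` of the continuous component -/
def sigmaX (s : SJD d m Ω) (A : Set (Rd d)) (ω : Ω) : ℝ≥0∞ :=
  hit s.X A ω

/-- first exit time `τ_D = inf{t ≥ 0 : X(t) ∉ D}` of the continuous component -/
def tauX (s : SJD d m Ω) (D : Set (Rd d)) (ω : Ω) : ℝ≥0∞ :=
  hit s.X Dᶜ ω

/-- first entrance time `σ_U` of the two-component process into `U ⊆ ℝ^d × M` -/
def sigmaZ (s : SJD d m Ω) (U : Set (Rd d × Fin m)) (ω : Ω) : ℝ≥0∞ :=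
  hit s.Z U ω

/-- `(X,Λ)` is recurrent with respect to `U`: `P_{x,i}(σ_U < ∞) = 1` for `(x,i) ∈ Uᶜ` -/
def Recurrent (s : SJD d m Ω) (U : Set (Rd d × Fin m)) : Prop :=
  ∀ x i, (x, i) ∉ U → s.P x i {ω | s.sigmaZ U ω < ⊤} = 1

/-- `(X,Λ)` is positive recurrent with respect to `U`: recurrent and `E_{x,i}[σ_U] < ∞` -/
def PosRecurrent (s : SJD d m Ω) (U : Set (Rd d × Fin m)) : Prop :=
  s.Recurrent U ∧ ∀ x i, (x, i) ∉ U → (∫⁻ ω, s.sigmaZ U ω ∂(s.P x i)) < ⊤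

/-- condition (C1) with respect to `D × M`, for a given Lyapunov function `V` -/
def IsLyapC1 (s : SJD d m Ω) (D : Set (Rd d)) (V : Rd d → Fin m → ℝ) : Prop :=
  (∀ i, ContDiff ℝ 2 fun y => V y i) ∧ (∀ x i, 0 ≤ V x i) ∧
    ∀ x ∉ D, ∀ i, s.G V x i ≤ -1

/-- condition (C1) with respect to `D × M` -/
def C1 (s : SJD d m Ω) (D : Set (Rd d)) : Prop :=
  ∃ V, s.IsLyapC1 D V

/-- condition (C2) with respect to `D × M`, for a given Lyapunov function `V` -/
def IsLyapC2 (s : SJD d m Ω) (D : Set (Rd d)) (V : Rd d → Fin m → ℝ) : Prop :=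
  (∀ i, ContDiff ℝ 2 fun y => V y i) ∧ (∀ x i, 0 ≤ V x i) ∧
    (∀ x ∉ D, ∀ i, s.G V x i ≤ 0) ∧
    (∀ K : ℝ, ∃ n : ℕ, ∀ x : Rd d, (n : ℝ) ≤ ‖x‖ → ∀ i, K ≤ V x i)

/-- `G` (i.e. the matrix `Q(·)`) is strictly irreducible on `D` -/
def StrictIrred (s : SJD d m Ω) (D : Set (Rd d)) : Prop :=
  ∀ i j : Fin m, i ≠ j → ∃ q0 > (0 : ℝ), ∀ x ∈ D, q0 ≤ s.q x i j

/-- `G` is strictly irreducible on every bounded domain -/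
def StrictIrredAll (s : SJD d m Ω) : Prop :=
  ∀ D : Set (Rd d), BddDomain D → s.StrictIrred D

end SJD


/-! ### Part 1: measurability and Fubini for the occupation measures -/

def rapp (n : ℕ) (k : ℤ) : ℝ := ((k : ℝ) + 1) / ((n : ℝ) + 1)

def kapp (n : ℕ) (u : ℝ) : ℤ := ⌊((n : ℝ) + 1) * u⌋

lemma kapp_meas (n : ℕ) : Measurable (kapp n) :=
  Int.measurable_floor.comp (measurable_const.mul measurable_id)

lemma rapp_tendsto (u : ℝ) : Tendsto (fun n => rapp n (kapp n u)) atTop (𝓝[≥] u) := by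
  refine tendsto_nhdsWithin_iff.2 ⟨?_, ?_⟩
  · have h1 : Tendsto (fun n : ℕ => u + 1 / ((n : ℝ) + 1)) atTop (𝓝 u) := by
      simpa using (tendsto_const_nhds (x := u)).add (tendsto_one_div_add_atTop_nhds_zero_nat (𝕜 := ℝ))
    refine tendsto_of_tendsto_of_tendsto_of_le_of_le tendsto_const_nhds h1 ?_ ?_
    · intro n
      have hn : (0 : ℝ) < (n : ℝ) + 1 := by positivity
      simp only [rapp, kapp]
      rw [le_div_iff₀ hn]
      have := Int.lt_floor_add_one (((n : ℝ) + 1) * u)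
      linarith
    · intro n
      have hn : (0 : ℝ) < (n : ℝ) + 1 := by positivity
      simp only [rapp, kapp]
      rw [div_le_iff₀ hn, add_mul u, div_mul_cancel₀ _ hn.ne']
      have := Int.floor_le (((n : ℝ) + 1) * u)
      linarith
  · refine Eventually.of_forall fun n => ?_
    have hn : (0 : ℝ) < (n : ℝ) + 1 := by positivity
    simp only [rapp, kapp, mem_Ici]
    rw [le_div_iff₀ hn]
    have := Int.lt_floor_add_one (((n : ℝ) + 1) * u)
    linarith

section Fub
set_option linter.unusedSectionVars false
variable {Ω E : Type*} [MeasurableSpace Ω] [TopologicalSpace E]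
  [TopologicalSpace.PseudoMetrizableSpace E] [MeasurableSpace E] [BorelSpace E]

lemma joint_meas (Y : ℝ → Ω → E) (hY : ∀ u, Measurable (Y u))
    (hr : ∀ ω u, ContinuousWithinAt (fun s => Y s ω) (Set.Ici u) u) :
    Measurable (fun q : ℝ × Ω => Y q.1 q.2) := by
  refine measurable_of_tendsto_metrizable (f := fun n q => Y (rapp n (kapp n q.1)) q.2) ?_ ?_
  · intro n
    have h : Measurable (fun q : ℤ × Ω => Y (rapp n q.1) q.2) :=
      measurable_from_prod_countable_right fun k => hY (rapp n k)
    exact h.comp (((kapp_meas n).comp measurable_fst).prodMk measurable_snd)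
  · rw [tendsto_pi_nhds]
    rintro ⟨u, ω⟩
    exact (hr ω u).tendsto.comp (rapp_tendsto u)

lemma fub_time (Y : ℝ → Ω → E) (hY : ∀ u, Measurable (Y u))
    (P : E → Measure Ω) (ν : Measure E)
    (hK : ∀ A, MeasurableSet A → ∀ u, AEMeasurable (fun p => P p (Y u ⁻¹' A)) ν ∧
      ∫⁻ p, P p (Y u ⁻¹' A) ∂ν = ν A) (g : E → ℝ≥0∞) (hg : Measurable g) (u : ℝ) :
    AEMeasurable (fun p => ∫⁻ ω, g (Y u ω) ∂(P p)) ν ∧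
      ∫⁻ p, ∫⁻ ω, g (Y u ω) ∂(P p) ∂ν = ∫⁻ p, g p ∂ν := by
  refine Measurable.ennreal_induction (motive := fun g =>
    AEMeasurable (fun p => ∫⁻ ω, g (Y u ω) ∂(P p)) ν ∧
      ∫⁻ p, ∫⁻ ω, g (Y u ω) ∂(P p) ∂ν = ∫⁻ p, g p ∂ν) ?_ ?_ ?_ hg
  · intro c s hs
    have h : ∀ p, ∫⁻ ω, s.indicator (fun _ => c) (Y u ω) ∂(P p) = c * P p (Y u ⁻¹' s) := by
      intro p
      rw [← lintegral_indicator_const (hY u hs)]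
      rfl
    simp_rw [h]
    obtain ⟨h1, h2⟩ := hK s hs u
    refine ⟨h1.const_mul c, ?_⟩
    rw [lintegral_const_mul'' _ h1, h2, lintegral_indicator_const hs]
  · intro f g _ hf hg ihf ihg
    have h : ∀ p, ∫⁻ ω, (f + g) (Y u ω) ∂(P p) =
        ∫⁻ ω, f (Y u ω) ∂(P p) + ∫⁻ ω, g (Y u ω) ∂(P p) := by
      intro p
      exact lintegral_add_left (hf.comp (hY u)) _
    simp_rw [h]
    refine ⟨ihf.1.add ihg.1, ?_⟩
    rw [lintegral_add_left' ihf.1, ihf.2, ihg.2, ← lintegral_add_left hf]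
    rfl
  · intro f hf hmono ih
    have h : ∀ p, ∫⁻ ω, ⨆ n, f n (Y u ω) ∂(P p) = ⨆ n, ∫⁻ ω, f n (Y u ω) ∂(P p) := by
      intro p
      exact lintegral_iSup (fun n => (hf n).comp (hY u)) (fun a b hab ω => hmono hab _)
    simp_rw [h]
    refine ⟨AEMeasurable.iSup fun n => (ih n).1, ?_⟩
    rw [lintegral_iSup' (fun n => (ih n).1), lintegral_iSup hf hmono]
    · simp_rw [(ih _).2]
    · refine Eventually.of_forall fun p a b hab => ?_
      exact lintegral_mono fun ω => hmono hab _

lemma fub_cont (Y : ℝ → Ω → E) (hY : ∀ u, Measurable (Y u))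
    (hr : ∀ ω u, ContinuousWithinAt (fun s => Y s ω) (Set.Ici u) u)
    (P : E → Measure Ω) [∀ p, IsProbabilityMeasure (P p)]
    (μ : Measure ℝ) [SFinite μ] (ν : Measure E) [SFinite ν]
    (hK : ∀ A, MeasurableSet A → ∀ u, AEMeasurable (fun p => P p (Y u ⁻¹' A)) ν ∧
      ∫⁻ p, P p (Y u ⁻¹' A) ∂ν = ν A) (g : E → ℝ≥0) (hg : Continuous g) (hb : ∀ p, g p ≤ 1) :
    AEMeasurable (fun q : ℝ × E => ∫⁻ ω, (g (Y q.1 ω) : ℝ≥0∞) ∂(P q.2)) (μ.prod ν) := by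
  have hgm : Measurable (fun p => (g p : ℝ≥0∞)) := by fun_prop
  refine aemeasurable_of_tendsto_metrizable_ae atTop
    (f := fun n q => ∫⁻ ω, (g (Y (rapp n (kapp n q.1)) ω) : ℝ≥0∞) ∂(P q.2)) ?_ ?_
  · intro n
    have h1 := fun k : ℤ => (fub_time Y hY P ν hK _ hgm (rapp n k)).1
    choose H hHm hHe using h1
    have hm : Measurable (fun q : ℤ × E => H q.1 q.2) :=
      measurable_from_prod_countable_right fun k => hHm k
    refine ⟨fun q => H (kapp n q.1) q.2,
      hm.comp (((kapp_meas n).comp measurable_fst).prodMk measurable_snd), ?_⟩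
    have h2 : ∀ᵐ p ∂ν, ∀ k, ∫⁻ ω, (g (Y (rapp n k) ω) : ℝ≥0∞) ∂(P p) = H k p :=
      ae_all_iff.2 hHe
    have h3 := (Measure.quasiMeasurePreserving_snd (μ := μ) (ν := ν)).ae h2
    filter_upwards [h3] with q hq
    exact hq _
  · refine Eventually.of_forall ?_
    rintro ⟨u, p⟩
    refine tendsto_lintegral_of_dominated_convergence (fun _ => 1) ?_ ?_ ?_ ?_
    · intro n; exact hgm.comp (hY _)
    · intro n; exact Eventually.of_forall fun ω => ENNReal.coe_le_one_iff.2 (hb _)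
    · simp
    · refine Eventually.of_forall fun ω => ?_
      have := (hr ω u).tendsto.comp (rapp_tendsto u)
      exact ENNReal.tendsto_coe.2 ((hg.tendsto _).comp this)

lemma fub_set (Y : ℝ → Ω → E) (hY : ∀ u, Measurable (Y u))
    (hr : ∀ ω u, ContinuousWithinAt (fun s => Y s ω) (Set.Ici u) u)
    (P : E → Measure Ω) [∀ p, IsProbabilityMeasure (P p)]
    (μ : Measure ℝ) [SFinite μ] (ν : Measure E) [SFinite ν]
    (hK : ∀ A, MeasurableSet A → ∀ u, AEMeasurable (fun p => P p (Y u ⁻¹' A)) ν ∧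
      ∫⁻ p, P p (Y u ⁻¹' A) ∂ν = ν A) (A : Set E) (hA : MeasurableSet A) :
    AEMeasurable (fun q : ℝ × E => P q.2 (Y q.1 ⁻¹' A)) (μ.prod ν) := by
  have heq : (inferInstance : MeasurableSpace E) = MeasurableSpace.generateFrom {s | IsClosed s} := by
    rw [← borel_eq_generateFrom_isClosed]; exact BorelSpace.measurable_eq
  induction A, hA using MeasurableSpace.induction_on_inter heq isPiSystem_isClosed with
  | empty => simp
  | basic F hF =>
    obtain ⟨g, hg1, hg2, hg3⟩ := HasOuterApproxClosed.exAppr F hF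
    refine aemeasurable_of_tendsto_metrizable_ae atTop
      (f := fun n q => ∫⁻ ω, (g n (Y q.1 ω) : ℝ≥0∞) ∂(P q.2))
      (fun n => fub_cont Y hY hr P μ ν hK _ (g n).continuous (hg1 n)) ?_
    refine Eventually.of_forall ?_
    rintro ⟨u, p⟩
    have hFm : MeasurableSet F := IsClosed.measurableSet hF
    have : P p (Y u ⁻¹' F) = ∫⁻ ω, ((F.indicator (fun _ => (1 : ℝ≥0)) (Y u ω) : ℝ≥0) : ℝ≥0∞) ∂(P p) := by
      rw [← lintegral_indicator_one (hY u hFm)]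
      refine lintegral_congr fun ω => ?_
      by_cases h : Y u ω ∈ F <;> simp [h]
    simp only [this]
    refine tendsto_lintegral_of_dominated_convergence (fun _ => 1) ?_ ?_ ?_ ?_
    · intro n
      have := (g n).continuous.measurable.comp (hY u)
      exact this.coe_nnreal_ennreal
    · intro n; exact Eventually.of_forall fun ω => ENNReal.coe_le_one_iff.2 (hg1 n _)
    · simp
    · refine Eventually.of_forall fun ω => ?_
      exact ENNReal.tendsto_coe.2 ((tendsto_pi_nhds.1 hg3) (Y u ω))
  | compl t ht ih =>
    have : (fun q : ℝ × E => P q.2 (Y q.1 ⁻¹' tᶜ)) = fun q => 1 - P q.2 (Y q.1 ⁻¹' t) := by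
      funext q
      rw [preimage_compl, prob_compl_eq_one_sub (hY _ ht)]
    rw [this]
    exact ih.const_sub 1
  | iUnion f hd hf ih =>
    have : (fun q : ℝ × E => P q.2 (Y q.1 ⁻¹' ⋃ i, f i)) = fun q => ∑' i, P q.2 (Y q.1 ⁻¹' f i) := by
      funext q
      rw [preimage_iUnion, measure_iUnion (fun i j hij => (hd hij).preimage _) (fun i => hY _ (hf i))]
    rw [this]
    exact AEMeasurable.tsum ih

lemma fub_fun (Y : ℝ → Ω → E) (hY : ∀ u, Measurable (Y u))
    (hr : ∀ ω u, ContinuousWithinAt (fun s => Y s ω) (Set.Ici u) u)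
    (P : E → Measure Ω) [∀ p, IsProbabilityMeasure (P p)]
    (μ : Measure ℝ) [SFinite μ] (ν : Measure E) [SFinite ν]
    (hK : ∀ A, MeasurableSet A → ∀ u, AEMeasurable (fun p => P p (Y u ⁻¹' A)) ν ∧
      ∫⁻ p, P p (Y u ⁻¹' A) ∂ν = ν A) (g : E → ℝ≥0∞) (hg : Measurable g) :
    AEMeasurable (fun q : ℝ × E => ∫⁻ ω, g (Y q.1 ω) ∂(P q.2)) (μ.prod ν) := by
  refine Measurable.ennreal_induction (motive := fun g =>
    AEMeasurable (fun q : ℝ × E => ∫⁻ ω, g (Y q.1 ω) ∂(P q.2)) (μ.prod ν)) ?_ ?_ ?_ hg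
  · intro c s hs
    have h : ∀ q : ℝ × E, ∫⁻ ω, s.indicator (fun _ => c) (Y q.1 ω) ∂(P q.2)
        = c * P q.2 (Y q.1 ⁻¹' s) := by
      intro q
      rw [← lintegral_indicator_const (hY q.1 hs)]
      rfl
    simp_rw [h]
    exact (fub_set Y hY hr P μ ν hK s hs).const_mul c
  · intro f g _ hf hg ihf ihg
    have h : ∀ q : ℝ × E, ∫⁻ ω, (f + g) (Y q.1 ω) ∂(P q.2) =
        ∫⁻ ω, f (Y q.1 ω) ∂(P q.2) + ∫⁻ ω, g (Y q.1 ω) ∂(P q.2) := by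
      intro q
      exact lintegral_add_left (hf.comp (hY q.1)) _
    simp_rw [h]
    exact ihf.add ihg
  · intro f hf hmono ih
    have h : ∀ q : ℝ × E, ∫⁻ ω, ⨆ n, f n (Y q.1 ω) ∂(P q.2)
        = ⨆ n, ∫⁻ ω, f n (Y q.1 ω) ∂(P q.2) := by
      intro q
      exact lintegral_iSup (fun n => (hf n).comp (hY q.1)) (fun a b hab ω => hmono hab _)
    simp_rw [h]
    exact AEMeasurable.iSup ih

lemma fub_final (Y : ℝ → Ω → E) (hY : ∀ u, Measurable (Y u))
    (hr : ∀ ω u, ContinuousWithinAt (fun s => Y s ω) (Set.Ici u) u)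
    (P : E → Measure Ω) [∀ p, IsProbabilityMeasure (P p)]
    (μ : Measure ℝ) [IsProbabilityMeasure μ] (ν : Measure E) [SFinite ν]
    (hK : ∀ A, MeasurableSet A → ∀ u, AEMeasurable (fun p => P p (Y u ⁻¹' A)) ν ∧
      ∫⁻ p, P p (Y u ⁻¹' A) ∂ν = ν A) (g : E → ℝ≥0∞) (hg : Measurable g) :
    AEMeasurable (fun p => ∫⁻ u, ∫⁻ ω, g (Y u ω) ∂(P p) ∂μ) ν ∧
    ∫⁻ p, ∫⁻ u, ∫⁻ ω, g (Y u ω) ∂(P p) ∂μ ∂ν = ∫⁻ p, g p ∂ν := by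
  have h := fub_fun Y hY hr P μ ν hK g hg
  refine ⟨h.lintegral_prod_left', ?_⟩
  rw [← lintegral_lintegral_swap (f := fun u p => ∫⁻ ω, g (Y u ω) ∂(P p)) h]
  simp_rw [(fub_time Y hY P ν hK g hg _).2]
  simp

/-- From boundedness and the real-valued invariance identity, recover measurability. -/
lemma inv_integrable (T : Ω → E) (hT : Measurable T)
    (P : E → Measure Ω) [∀ p, IsProbabilityMeasure (P p)] (ν : Measure E) [IsProbabilityMeasure ν]
    (hinv : ∀ f : E → ℝ, Measurable f → (∃ C : ℝ, ∀ p, |f p| ≤ C) →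
        ∫ p, (∫ ω, f (T ω) ∂(P p)) ∂ν = ∫ p, f p ∂ν)
    (f : E → ℝ) (hf : Measurable f) (hb : ∃ C : ℝ, ∀ p, |f p| ≤ C) :
    Integrable (fun p => ∫ ω, f (T ω) ∂(P p)) ν := by
  obtain ⟨C, hC⟩ := hb
  have hfi : Integrable f ν := Integrable.of_bound hf.aestronglyMeasurable C
    (Eventually.of_forall hC)
  by_contra hn
  have h1 := hinv f hf ⟨C, hC⟩
  have h2 := hinv (fun p => f p + 1) (hf.add_const 1)
    ⟨C + 1, fun p => (abs_add_le _ _).trans (by simpa using hC p)⟩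
  have h3 : (fun p => ∫ ω, (f (T ω) + 1) ∂(P p)) = fun p => (∫ ω, f (T ω) ∂(P p)) + 1 := by
    funext p
    rw [integral_add]
    · simp
    · exact Integrable.of_bound (hf.comp hT).aestronglyMeasurable C
        (Eventually.of_forall fun ω => hC _)
    · simp
  rw [h3, integral_undef, integral_add hfi (by simp)] at h2
  · rw [integral_undef hn] at h1
    rw [← h1] at h2
    simp at h2
  · intro h
    apply hn
    have h5 := h.sub (integrable_const (1 : ℝ))
    refine h5.congr (Eventually.of_forall fun p => ?_)
    simp

lemma inv_set (T : Ω → E) (hT : Measurable T)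
    (P : E → Measure Ω) [∀ p, IsProbabilityMeasure (P p)] (ν : Measure E) [IsProbabilityMeasure ν]
    (hinv : ∀ f : E → ℝ, Measurable f → (∃ C : ℝ, ∀ p, |f p| ≤ C) →
        ∫ p, (∫ ω, f (T ω) ∂(P p)) ∂ν = ∫ p, f p ∂ν)
    (A : Set E) (hA : MeasurableSet A) :
    AEMeasurable (fun p => P p (T ⁻¹' A)) ν ∧ ∫⁻ p, P p (T ⁻¹' A) ∂ν = ν A := by
  have hm : Measurable (A.indicator (fun _ => (1 : ℝ))) := measurable_const.indicator hA
  have hb : ∃ C : ℝ, ∀ p, |A.indicator (fun _ => (1 : ℝ)) p| ≤ C :=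
    ⟨1, fun p => by by_cases h : p ∈ A <;> simp [h]⟩
  have h1 := inv_integrable T hT P ν hinv _ hm hb
  have h2 := hinv _ hm hb
  have h3 : (fun p => ∫ ω, A.indicator (fun _ => (1 : ℝ)) (T ω) ∂(P p)) =
      fun p => (P p (T ⁻¹' A)).toReal := by
    funext p
    have := integral_indicator_one (μ := P p) (hT hA)
    rw [Measure.real] at this
    rw [← this]
    rfl
  rw [h3] at h1
  have h3' := fun p => congrFun h3 p
  simp only [h3'] at h2
  have hae : AEMeasurable (fun p => P p (T ⁻¹' A)) ν := by
    have := h1.aestronglyMeasurable.aemeasurable.ennreal_ofReal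
    simpa [ENNReal.ofReal_toReal, measure_ne_top] using this
  refine ⟨hae, ?_⟩
  rw [integral_toReal hae (Eventually.of_forall fun p => measure_lt_top _ _)] at h2
  have h4 : ∫ p, A.indicator (fun _ => (1 : ℝ)) p ∂ν = (ν A).toReal := by
    have := integral_indicator_one (μ := ν) hA
    rw [Measure.real] at this
    rw [← this]
    rfl
  rw [h4] at h2
  refine (ENNReal.toReal_eq_toReal_iff' ?_ (measure_ne_top _ _)).1 h2
  refine ne_top_of_le_ne_top (b := 1) (by simp) ?_
  calc _ ≤ ∫⁻ p, 1 ∂ν := lintegral_mono fun p => prob_le_one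
    _ = 1 := by simp

end Fub

/-! ### Part 2: `∫ G f dν = 0` -/

section Zero
variable {d m : ℕ} {Ω : Type} [MeasurableSpace Ω]

lemma lint_add_const {α : Type*} [MeasurableSpace α] (ρ : Measure α) [IsProbabilityMeasure ρ]
    (F : α → ℝ) (hF : Integrable F ρ) (C : ℝ) (h : ∀ x, 0 ≤ F x + C) :
    ∫⁻ x, ENNReal.ofReal (F x + C) ∂ρ = ENNReal.ofReal ((∫ x, F x ∂ρ) + C) ∧
      0 ≤ (∫ x, F x ∂ρ) + C := by
  have hi : Integrable (fun x => F x + C) ρ := hF.add (integrable_const C)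
  have he : ∫ x, (F x + C) ∂ρ = (∫ x, F x ∂ρ) + C := by
    rw [integral_add hF (integrable_const C)]; simp
  rw [← ofReal_integral_eq_lintegral_ofReal hi (Eventually.of_forall h), he]
  exact ⟨rfl, he ▸ integral_nonneg h⟩

lemma dynkin (s : SJD d m Ω) (f : Rd d → Fin m → ℝ)
    (hf : ∀ i, ContDiff ℝ 2 fun y => f y i)
    (hfb : ∀ i, ∃ C : ℝ, ∀ x, |f x i| ≤ C ∧ ‖fderiv ℝ (fun y => f y i) x‖ ≤ C ∧
        ‖iteratedFDeriv ℝ 2 (fun y => f y i) x‖ ≤ C)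
    (K : ℝ) (hK : ∀ x i, |f x i| ≤ K) (hfm : Measurable fun p : Rd d × Fin m => f p.1 p.2)
    (hZ : ∀ t, Measurable (s.Z t)) (x : Rd d) (i : Fin m) :
    Integrable (fun ω => ∫ u in Set.Ioc (0 : ℝ) 1, s.G f (s.X u.toNNReal ω) (s.Λ u.toNNReal ω))
      (s.P x i) ∧
    ∫ ω, (∫ u in Set.Ioc (0 : ℝ) 1, s.G f (s.X u.toNNReal ω) (s.Λ u.toNNReal ω)) ∂(s.P x i)
      = (∫ ω, f (s.X 1 ω) (s.Λ 1 ω) ∂(s.P x i)) - f x i := by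
  have := s.prob x i
  have hM := s.martingale_problem f hf hfb x i
  have hi1 := hM.integrable 1
  have h01 := hM.setIntegral_eq (zero_le_one (α := ℝ≥0)) (s := Set.univ) MeasurableSet.univ
  rw [setIntegral_univ, setIntegral_univ] at h01
  have h0 : ∀ᵐ ω ∂(s.P x i), s.X 0 ω = x ∧ s.Λ 0 ω = i := by
    have hm : MeasurableSet {ω | s.X 0 ω = x ∧ s.Λ 0 ω = i} := by
      have := hZ 0 (measurableSet_singleton (x, i))
      convert this using 1
      ext ω
      simp [SJD.Z]
    rw [ae_iff]
    have := (prob_compl_eq_zero_iff hm).2 (s.init x i)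
    exact this
  have hz : ∫ ω, (fun (t : ℝ≥0) ω => f (s.X t ω) (s.Λ t ω) - f x i -
        ∫ u in Set.Ioc (0 : ℝ) (t : ℝ),
          gen (fun y j => s.sig y j * (s.sig y j)ᵀ) s.b
            (fun y j => volume.withDensity fun z => ENNReal.ofReal (s.pit y j z)) s.q f
            (s.X u.toNNReal ω) (s.Λ u.toNNReal ω)) 0 ω ∂(s.P x i) = 0 := by
    rw [← integral_zero Ω ℝ (μ := s.P x i)]
    refine integral_congr_ae ?_
    filter_upwards [h0] with ω hω
    simp [hω.1, hω.2]
  rw [hz] at h01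
  have hfi : Integrable (fun ω => f (s.X 1 ω) (s.Λ 1 ω)) (s.P x i) :=
    Integrable.of_bound (hfm.comp (hZ 1)).aestronglyMeasurable K
      (Eventually.of_forall fun ω => hK _ _)
  have hfi' : Integrable (fun ω => f (s.X 1 ω) (s.Λ 1 ω) - f x i) (s.P x i) :=
    hfi.sub (integrable_const _)
  have hI : Integrable
      (fun ω => ∫ u in Set.Ioc (0 : ℝ) 1, s.G f (s.X u.toNNReal ω) (s.Λ u.toNNReal ω))
      (s.P x i) := by
    refine (hfi'.sub hi1).congr (Eventually.of_forall fun ω => ?_)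
    simp only [Pi.sub_apply, NNReal.coe_one, sub_sub_cancel]
    rfl
  refine ⟨hI, ?_⟩
  have h2 := integral_sub hfi' hI
  have h3 : ∫ ω, ((f (s.X 1 ω) (s.Λ 1 ω) - f x i) -
    ∫ u in Set.Ioc (0 : ℝ) 1, s.G f (s.X u.toNNReal ω) (s.Λ u.toNNReal ω)) ∂(s.P x i) = 0 := h01.symm
  rw [h3, integral_sub hfi (integrable_const _)] at h2
  simp at h2
  linarith

lemma int_G_zero (s : SJD d m Ω)
    (ν : Measure (Rd d × Fin m)) (hν : IsProbabilityMeasure ν)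
    (hinv : ∀ f : Rd d × Fin m → ℝ, Measurable f → (∃ C : ℝ, ∀ p, |f p| ≤ C) →
      ∀ t : ℝ≥0,
        ∫ p, (∫ ω, f (s.Z t ω) ∂(s.P p.1 p.2)) ∂ν = ∫ p, f p ∂ν)
    (f : Rd d → Fin m → ℝ)
    (hf : ∀ i, ContDiff ℝ 2 fun y => f y i)
    (hfb : ∀ i, ∃ C : ℝ, ∀ x, |f x i| ≤ C ∧ ‖fderiv ℝ (fun y => f y i) x‖ ≤ C ∧
        ‖iteratedFDeriv ℝ 2 (fun y => f y i) x‖ ≤ C)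
    (K : ℝ) (hK : ∀ x i, |f x i| ≤ K) (hfm : Measurable fun p : Rd d × Fin m => f p.1 p.2)
    (hGm : Measurable fun p : Rd d × Fin m => s.G f p.1 p.2)
    (C : ℝ) (hGb : ∀ x i, |s.G f x i| ≤ C) :
    Integrable (fun p : Rd d × Fin m => s.G f p.1 p.2) ν ∧
    ∫ p, s.G f p.1 p.2 ∂ν = 0 := by
  have hZ : ∀ t, Measurable (s.Z t) := fun t => (s.adapted t).mono (s.ℱ.le t) le_rfl
  have hP : ∀ p : Rd d × Fin m, IsProbabilityMeasure ((fun p => s.P p.1 p.2) p) :=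
    fun p => s.prob p.1 p.2
  have hGi : Integrable (fun p : Rd d × Fin m => s.G f p.1 p.2) ν :=
    Integrable.of_bound hGm.aestronglyMeasurable C (Eventually.of_forall fun p => hGb _ _)
  refine ⟨hGi, ?_⟩
  set Y : ℝ → Ω → Rd d × Fin m := fun u ω => s.Z u.toNNReal ω with hYdef
  have hY : ∀ u, Measurable (Y u) := fun u => hZ _
  have hr : ∀ ω u, ContinuousWithinAt (fun t => Y t ω) (Set.Ici u) u := by
    intro ω u
    have h1 := s.cadlag_right ω u.toNNReal
    refine ContinuousWithinAt.comp (t := Set.Ici u.toNNReal) h1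
      continuous_real_toNNReal.continuousWithinAt ?_
    intro v hv
    exact Real.toNNReal_le_toNNReal hv
  have hKer := fun A hA u => inv_set (Y u) (hY u) (fun p : Rd d × Fin m => s.P p.1 p.2) ν
    (fun f hf hb => hinv f hf hb u.toNNReal) A hA
  set μ : Measure ℝ := volume.restrict (Set.Ioc (0 : ℝ) 1) with hμ
  have : IsProbabilityMeasure μ := ⟨by simp [hμ]⟩
  have hgm : Measurable (fun p : Rd d × Fin m => ENNReal.ofReal (s.G f p.1 p.2 + C)) :=
    (hGm.add_const C).ennreal_ofReal
  obtain ⟨hW1, hW2⟩ := fub_final Y hY hr (fun p : Rd d × Fin m => s.P p.1 p.2) μ ν hKer _ hgm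
  have hjm := joint_meas Y hY hr
  have hC0 : ∀ p : Rd d × Fin m, 0 ≤ s.G f p.1 p.2 + C := fun p => by
    have := (abs_le.1 (hGb p.1 p.2)).1
    linarith
  have hWp : ∀ p : Rd d × Fin m, ∫⁻ u, ∫⁻ ω, ENNReal.ofReal (s.G f (Y u ω).1 (Y u ω).2 + C)
      ∂(s.P p.1 p.2) ∂μ =
      ENNReal.ofReal ((∫ ω, f (s.X 1 ω) (s.Λ 1 ω) ∂(s.P p.1 p.2)) - f p.1 p.2 + C) := by
    intro p
    have := s.prob p.1 p.2
    rw [lintegral_lintegral_swap (f := fun u ω =>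
      ENNReal.ofReal (s.G f (Y u ω).1 (Y u ω).2 + C)) (hgm.comp hjm).aemeasurable]
    obtain ⟨hd1, hd2⟩ := dynkin s f hf hfb K hK hfm hZ p.1 p.2
    have hin : ∀ ω, Integrable (fun u => s.G f (Y u ω).1 (Y u ω).2) μ := fun ω =>
      Integrable.of_bound ((hGm.comp hjm).comp measurable_prodMk_right).aestronglyMeasurable C
        (Eventually.of_forall fun u => hGb _ _)
    have h1 := fun ω => lint_add_const μ _ (hin ω) C (fun u => hC0 _)
    simp_rw [(h1 _).1]
    rw [← hd2]
    exact (lint_add_const _ _ hd1 C (fun ω => (h1 ω).2)).1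
  have hWnn : ∀ p : Rd d × Fin m,
      0 ≤ (∫ ω, f (s.X 1 ω) (s.Λ 1 ω) ∂(s.P p.1 p.2)) - f p.1 p.2 + C := by
    intro p
    have := s.prob p.1 p.2
    obtain ⟨hd1, hd2⟩ := dynkin s f hf hfb K hK hfm hZ p.1 p.2
    rw [← hd2]
    have h1 : |∫ ω, (∫ u in Set.Ioc (0 : ℝ) 1, s.G f (s.X u.toNNReal ω) (s.Λ u.toNNReal ω))
        ∂(s.P p.1 p.2)| ≤ C := by
      have := norm_integral_le_of_norm_le_const (μ := s.P p.1 p.2) (C := C)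
        (f := fun ω => ∫ u in Set.Ioc (0 : ℝ) 1, s.G f (s.X u.toNNReal ω) (s.Λ u.toNNReal ω))
        (Eventually.of_forall fun ω => by
          have := norm_integral_le_of_norm_le_const (μ := μ) (C := C)
            (f := fun u => s.G f (s.X u.toNNReal ω) (s.Λ u.toNNReal ω))
            (Eventually.of_forall fun u => hGb _ _)
          simpa using this)
      simpa using this
    have := (abs_le.1 h1).1
    linarith
  simp only [hWp] at hW2
  have hfi : Integrable (fun p : Rd d × Fin m => f p.1 p.2) ν :=
    Integrable.of_bound hfm.aestronglyMeasurable K (Eventually.of_forall fun p => hK _ _)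
  have hEi := inv_integrable (s.Z 1) (hZ 1) (fun p : Rd d × Fin m => s.P p.1 p.2) ν
    (fun f hf hb => hinv f hf hb 1) _ hfm ⟨K, fun p => hK _ _⟩
  have hE := hinv _ hfm ⟨K, fun p => hK _ _⟩ 1
  have hi1 : Integrable (fun p : Rd d × Fin m =>
      (∫ ω, f (s.X 1 ω) (s.Λ 1 ω) ∂(s.P p.1 p.2)) - f p.1 p.2) ν := hEi.sub hfi
  have e1 := lint_add_const ν _ hi1 C hWnn
  have e2 := lint_add_const ν _ hGi C hC0
  rw [e1.1, e2.1, ENNReal.ofReal_eq_ofReal_iff e1.2 e2.2] at hW2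
  have e3 := integral_sub hEi hfi
  have e5 : ∫ p : Rd d × Fin m, ((∫ ω, f (s.X 1 ω) (s.Λ 1 ω) ∂(s.P p.1 p.2)) - f p.1 p.2) ∂ν = 0 := by
    refine e3.trans ?_
    rw [sub_eq_zero]
    exact hE
  rw [e5] at hW2
  linarith

end Zero

/-! ### Part 3: the bump function -/

section Bump

lemma hasDerivAt_of_sq {g : ℝ → ℝ} {g' t C : ℝ}
    (h : ∀ x : ℝ, |x| ≤ 1 → |g (t + x) - g t - g' * x| ≤ C * x ^ 2) : HasDerivAt g g' t := by
  rw [hasDerivAt_iff_isLittleO_nhds_zero]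
  have h1 : (fun x : ℝ => g (t + x) - g t - x • g') =O[𝓝 0] fun x => x ^ 2 := by
    refine Asymptotics.IsBigO.of_bound C ?_
    have : ∀ᶠ x : ℝ in 𝓝 0, |x| < 1 := by
      have := Metric.ball_mem_nhds (0 : ℝ) one_pos
      filter_upwards [this] with x hx
      simpa using hx
    filter_upwards [this] with x hx
    have := h x hx.le
    rw [Real.norm_eq_abs, Real.norm_eq_abs, abs_of_nonneg (sq_nonneg x), smul_eq_mul, mul_comm x]
    exact this
  exact h1.trans_isLittleO (Asymptotics.isLittleO_pow_id one_lt_two)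

lemma cube_conv (t h : ℝ) : 0 ≤ max (t + h) 0 ^ 3 - max t 0 ^ 3 - 3 * max t 0 ^ 2 * h := by
  rcases le_total t 0 with ht | ht <;> rcases le_total (t + h) 0 with hh | hh
  · simp [max_eq_right ht, max_eq_right hh]
  · simp only [max_eq_right ht, max_eq_left hh]
    have := pow_nonneg hh 3
    nlinarith
  · simp only [max_eq_left ht, max_eq_right hh]
    have : 0 ≤ t ^ 2 * (-(t + h)) := mul_nonneg (sq_nonneg t) (by linarith)
    have h3 : 0 ≤ t ^ 2 * t := by positivity
    nlinarith
  · simp only [max_eq_left ht, max_eq_left hh]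
    have h3 : 0 ≤ h ^ 2 * (t + h) := by positivity
    have h4 : 0 ≤ h ^ 2 * t := by positivity
    nlinarith

lemma cube_upper (t h : ℝ) :
    max (t + h) 0 ^ 3 - max t 0 ^ 3 - 3 * max t 0 ^ 2 * h ≤ 3 * |t| * h ^ 2 + |h| ^ 3 := by
  have hh3 : h ^ 3 ≤ |h| ^ 3 := by
    rw [← abs_pow]; exact le_abs_self _
  have ha : 0 ≤ |h| ^ 3 := by positivity
  rcases le_total t 0 with ht | ht <;> rcases le_total (t + h) 0 with hh | hh
  · simp [max_eq_right ht, max_eq_right hh]; positivity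
  · simp only [max_eq_right ht, max_eq_left hh]
    have : (t + h) ^ 3 ≤ h ^ 3 := pow_le_pow_left₀ hh (by linarith) 3
    have h4 : 0 ≤ 3 * |t| * h ^ 2 := by positivity
    nlinarith
  · simp only [max_eq_left ht, max_eq_right hh]
    rw [abs_of_nonneg ht]
    have h1 : 0 ≤ t * (-h) * (-(t + h)) :=
      mul_nonneg (mul_nonneg ht (by linarith)) (by linarith)
    have h3 : 0 ≤ t ^ 2 * t := by positivity
    nlinarith
  · simp only [max_eq_left ht, max_eq_left hh]
    rw [abs_of_nonneg ht]
    nlinarith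

lemma cube_deriv (t : ℝ) : HasDerivAt (fun t : ℝ => max t 0 ^ 3) (3 * max t 0 ^ 2) t := by
  refine hasDerivAt_of_sq (C := 3 * |t| + 1) fun x hx => ?_
  have h1 := cube_conv t x
  have h2 := cube_upper t x
  rw [abs_of_nonneg h1]
  have h3 : |x| ^ 3 ≤ x ^ 2 := by
    rw [← sq_abs x, pow_succ]
    have := mul_le_mul_of_nonneg_left hx (sq_nonneg |x|)
    linarith
  nlinarith

lemma sq_deriv (t : ℝ) : HasDerivAt (fun t : ℝ => max t 0 ^ 2) (2 * max t 0) t := by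
  refine hasDerivAt_of_sq (C := 1) fun x hx => ?_
  rcases le_total t 0 with ht | ht <;> rcases le_total (t + x) 0 with hh | hh
  · simp [max_eq_right ht, max_eq_right hh]; positivity
  · simp only [max_eq_right ht, max_eq_left hh]
    have : (t + x) ^ 2 ≤ x ^ 2 := pow_le_pow_left₀ hh (by linarith) 2
    rw [abs_of_nonneg (by nlinarith [sq_nonneg (t + x)])]
    nlinarith
  · simp only [max_eq_left ht, max_eq_right hh]
    rw [abs_le]
    constructor <;> nlinarith [mul_nonneg ht (neg_nonneg.2 hh), sq_nonneg (t + x)]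
  · simp only [max_eq_left ht, max_eq_left hh]
    rw [abs_le]
    constructor <;> nlinarith [sq_nonneg x]

lemma cube_contDiff : ContDiff ℝ 2 (fun t : ℝ => max t 0 ^ 3) := by
  have h2 : (2 : WithTop ℕ∞) = 1 + 1 := by norm_num
  have h1 : (1 : WithTop ℕ∞) = 0 + 1 := by norm_num
  rw [h2, contDiff_succ_iff_deriv]
  refine ⟨fun t => (cube_deriv t).differentiableAt, by simp, ?_⟩
  have e : deriv (fun t : ℝ => max t 0 ^ 3) = fun t => 3 * max t 0 ^ 2 :=
    funext fun t => (cube_deriv t).deriv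
  rw [e]
  refine contDiff_const.mul ?_
  rw [h1, contDiff_succ_iff_deriv]
  refine ⟨fun t => (sq_deriv t).differentiableAt, by simp, ?_⟩
  have e : deriv (fun t : ℝ => max t 0 ^ 2) = fun t => 2 * max t 0 :=
    funext fun t => (sq_deriv t).deriv
  rw [e, contDiff_zero]
  fun_prop

variable {d : ℕ}

def tp (y : Rd d) (S : ℝ) (x : Rd d) : ℝ := max (S - ‖x - y‖ ^ 2) 0

def bump (y : Rd d) (S : ℝ) (x : Rd d) : ℝ := tp y S x ^ 3

lemma tp_nonneg (y : Rd d) (S : ℝ) (x : Rd d) : 0 ≤ tp y S x := le_max_right _ _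

lemma tp_cont (y : Rd d) (S : ℝ) : Continuous (tp y S) := by unfold tp; fun_prop

lemma bump_contDiff (y : Rd d) (S : ℝ) : ContDiff ℝ 2 (bump y S) := by
  have : ContDiff ℝ 2 (fun x : Rd d => S - ‖x - y‖ ^ 2) :=
    contDiff_const.sub ((contDiff_id.sub contDiff_const).norm_sq ℝ)
  exact cube_contDiff.comp this

lemma base_deriv (y : Rd d) (S : ℝ) (x : Rd d) :
    HasFDerivAt (fun x : Rd d => S - ‖x - y‖ ^ 2) ((-2 : ℝ) • innerSL ℝ (x - y)) x := by
  have h := (((hasFDerivAt_id x).sub_const y).norm_sq).const_sub S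
  refine h.congr_fderiv ?_
  ext v
  simp

lemma bump_deriv (y : Rd d) (S c : ℝ) (x : Rd d) :
    HasFDerivAt (fun x => c * bump y S x) ((-6 * c * tp y S x ^ 2) • innerSL ℝ (x - y)) x := by
  have h := (cube_deriv (S - ‖x - y‖ ^ 2)).comp_hasFDerivAt x (base_deriv y S x)
  have h2 := h.const_mul c
  refine h2.congr_fderiv ?_
  ext v
  simp [tp]
  ring

lemma bump_deriv2 (y : Rd d) (S c : ℝ) (x v w : Rd d) :
    iteratedFDeriv ℝ 2 (fun x => c * bump y S x) x ![v, w] =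
      c * (24 * tp y S x * (inner ℝ (x - y) v * inner ℝ (x - y) w)
        - 6 * tp y S x ^ 2 * inner ℝ v w) := by
  rw [iteratedFDeriv_two_apply]
  have e : fderiv ℝ (fun x => c * bump y S x) =
      fun x => (-6 * c * tp y S x ^ 2) • innerSL ℝ (x - y) :=
    funext fun x => (bump_deriv y S c x).fderiv
  rw [e]
  have h := ((sq_deriv (S - ‖x - y‖ ^ 2)).comp_hasFDerivAt x (base_deriv y S x)).const_mul (-6 * c)
  have hl : HasFDerivAt (fun x : Rd d => innerSL ℝ (x - y)) (innerSL ℝ : Rd d →L[ℝ] _) x := by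
    have := (innerSL ℝ : Rd d →L[ℝ] Rd d →L[ℝ] ℝ).hasFDerivAt (x := x - y)
    exact this.comp x ((hasFDerivAt_id x).sub_const y)
  have h3 := h.fun_smul hl
  have h4 : HasFDerivAt (fun x => (-6 * c * tp y S x ^ 2) • innerSL ℝ (x - y)) _ x := h3
  rw [h4.fderiv]
  have hvw : ((innerSL ℝ) v) w = inner ℝ v w := rfl
  simp [tp, inner_sub_left]
  try rw [hvw]
  ring

lemma bump_zero (y : Rd d) (S : ℝ) (x : Rd d) (h : S ≤ ‖x - y‖ ^ 2) : tp y S x = 0 := by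
  unfold tp; exact max_eq_right (by linarith)

lemma tp_cpt (y : Rd d) (S : ℝ) : HasCompactSupport (tp y S) := by
  refine HasCompactSupport.intro (isCompact_closedBall y (|S| + 1)) fun x hx => ?_
  apply bump_zero
  rw [mem_closedBall, dist_eq_norm, not_le] at hx
  nlinarith [le_abs_self S, abs_nonneg S]

lemma bump_cpt (y : Rd d) (S : ℝ) : HasCompactSupport (bump y S) :=
  (tp_cpt y S).comp_left (g := fun t => t ^ 3) (by simp)

lemma tp_le (y : Rd d) (S : ℝ) (x : Rd d) : tp y S x ≤ |S| := by
  unfold tp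
  refine max_le ?_ (abs_nonneg S)
  nlinarith [le_abs_self S, sq_nonneg ‖x - y‖]

lemma bump_bdds (y : Rd d) (S c : ℝ) : ∃ C : ℝ, ∀ x, |c * bump y S x| ≤ C ∧
    ‖fderiv ℝ (fun x => c * bump y S x) x‖ ≤ C ∧
      ‖iteratedFDeriv ℝ 2 (fun x => c * bump y S x) x‖ ≤ C := by
  have hc : ContDiff ℝ 2 (fun x => c * bump y S x) := contDiff_const.mul (bump_contDiff y S)
  have hs : HasCompactSupport (fun x => c * bump y S x) := (bump_cpt y S).mul_left
  obtain ⟨C1, h1⟩ := hc.continuous.bounded_above_of_compact_support hs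
  obtain ⟨C2, h2⟩ := (hc.continuous_fderiv (by norm_num)).bounded_above_of_compact_support
    (hs.fderiv (𝕜 := ℝ))
  obtain ⟨C3, h3⟩ := (hc.continuous_iteratedFDeriv (m := 2) (by norm_num)).bounded_above_of_compact_support
    (hs.iteratedFDeriv (𝕜 := ℝ) 2)
  refine ⟨max C1 (max C2 C3), fun x => ⟨(h1 x).trans (le_max_left _ _),
    (h2 x).trans ((le_max_left _ _).trans (le_max_right _ _)),
    (h3 x).trans ((le_max_right _ _).trans (le_max_right _ _))⟩⟩

/-- the integrand of the jump part -/
def Fj (y : Rd d) (S : ℝ) (x z : Rd d) : ℝ :=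
  bump y S (x + z) - bump y S x + (if ‖z‖ < 1 then 6 * tp y S x ^ 2 * inner ℝ (x - y) z else 0)

lemma norm_shift (y x z : Rd d) :
    ‖x + z - y‖ ^ 2 = ‖x - y‖ ^ 2 + 2 * inner ℝ (x - y) z + ‖z‖ ^ 2 := by
  rw [show x + z - y = (x - y) + z by abel]
  exact norm_add_sq_real _ _

lemma Fj_small (y : Rd d) (S : ℝ) (x z : Rd d) (hz : ‖z‖ < 1) :
    Fj y S x z = (max ((S - ‖x - y‖ ^ 2) + (-2 * inner ℝ (x - y) z - ‖z‖ ^ 2)) 0 ^ 3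
      - max (S - ‖x - y‖ ^ 2) 0 ^ 3
      - 3 * max (S - ‖x - y‖ ^ 2) 0 ^ 2 * (-2 * inner ℝ (x - y) z - ‖z‖ ^ 2))
      - 3 * tp y S x ^ 2 * ‖z‖ ^ 2 := by
  simp only [Fj, bump, tp, if_pos hz, norm_shift]
  rw [show S - (‖x - y‖ ^ 2 + 2 * inner ℝ (x - y) z + ‖z‖ ^ 2) =
    (S - ‖x - y‖ ^ 2) + (-2 * inner ℝ (x - y) z - ‖z‖ ^ 2) by ring]
  ring

def Hj (A B : ℝ) (z : Rd d) : ℝ := if ‖z‖ < 1 then A * ‖z‖ ^ 2 else B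

lemma Fj_lower (y : Rd d) (S : ℝ) (x z : Rd d) :
    -Hj (3 * tp y S x ^ 2) (tp y S x ^ 3) z ≤ Fj y S x z := by
  unfold Hj
  split_ifs with hz
  · rw [Fj_small y S x z hz]
    have := cube_conv (S - ‖x - y‖ ^ 2) (-2 * inner ℝ (x - y) z - ‖z‖ ^ 2)
    linarith
  · simp only [Fj, if_neg hz, bump]
    have := pow_nonneg (tp_nonneg y S (x + z)) 3
    linarith

lemma Fj_upper (y : Rd d) (S : ℝ) : ∃ A B : ℝ, 0 ≤ A ∧ 0 ≤ B ∧ ∀ x z : Rd d,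
    |Fj y S x z| ≤ Hj (if ‖x - y‖ < |S| + 2 then A else 0) B z := by
  set N := |S| + 2 with hN
  have hS := abs_nonneg S
  have hN0 : 0 ≤ N := by positivity
  refine ⟨3 * (|S| + N ^ 2) * (2 * N + 1) ^ 2 + (2 * N + 1) ^ 3 + 3 * |S| ^ 2, |S| ^ 3,
    by positivity, by positivity, fun x z => ?_⟩
  have ht0 := tp_nonneg y S x
  have ht1 := tp_le y S x
  by_cases hz : ‖z‖ < 1
  swap
  · simp only [Hj, Fj, if_neg hz, bump, add_zero]
    have h1 := pow_nonneg ht0 3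
    have h2 := pow_le_pow_left₀ ht0 ht1 3
    have h3 := pow_nonneg (tp_nonneg y S (x + z)) 3
    have h4 := pow_le_pow_left₀ (tp_nonneg y S (x + z)) (tp_le y S (x + z)) 3
    rw [abs_le]; constructor <;> linarith
  by_cases hx : ‖x - y‖ < N
  · simp only [Hj, if_pos hz, if_pos hx]
    rw [Fj_small y S x z hz]
    set w := ‖x - y‖ with hw
    have hw0 : 0 ≤ w := norm_nonneg _
    set h := -2 * inner ℝ (x - y) z - ‖z‖ ^ 2 with hh
    have hz0 := norm_nonneg z
    have hi : |inner ℝ (x - y) z| ≤ N * ‖z‖ :=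
      (abs_real_inner_le_norm _ _).trans (mul_le_mul_of_nonneg_right hx.le hz0)
    have habs : |h| ≤ (2 * N + 1) * ‖z‖ := by
      rw [abs_le] at hi ⊢
      constructor <;> nlinarith
    have h1 := cube_conv (S - w ^ 2) h
    have h2 := cube_upper (S - w ^ 2) h
    have hr : |S - w ^ 2| ≤ |S| + N ^ 2 := by
      have : w ^ 2 ≤ N ^ 2 := pow_le_pow_left₀ hw0 hx.le 2
      refine (abs_sub _ _).trans ?_
      rw [abs_of_nonneg (sq_nonneg w)]
      linarith
    have e1 : h ^ 2 ≤ (2 * N + 1) ^ 2 * ‖z‖ ^ 2 := by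
      rw [← sq_abs h, ← mul_pow]
      exact pow_le_pow_left₀ (abs_nonneg h) habs 2
    have e2 : |h| ^ 3 ≤ (2 * N + 1) ^ 3 * ‖z‖ ^ 2 := by
      have a1 := pow_le_pow_left₀ (abs_nonneg h) habs 3
      rw [mul_pow] at a1
      refine a1.trans ?_
      refine mul_le_mul_of_nonneg_left ?_ (by positivity)
      exact pow_le_pow_of_le_one hz0 hz.le (by norm_num)
    have e3 : 3 * |S - w ^ 2| * h ^ 2 ≤ 3 * (|S| + N ^ 2) * ((2 * N + 1) ^ 2 * ‖z‖ ^ 2) := by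
      gcongr
    have e4 : 3 * tp y S x ^ 2 * ‖z‖ ^ 2 ≤ 3 * |S| ^ 2 * ‖z‖ ^ 2 := by gcongr
    have e5 : 0 ≤ 3 * tp y S x ^ 2 * ‖z‖ ^ 2 := by positivity
    have e6 : 0 ≤ 3 * (|S| + N ^ 2) * ((2 * N + 1) ^ 2 * ‖z‖ ^ 2) := by positivity
    have e7 : 0 ≤ (2 * N + 1) ^ 3 * ‖z‖ ^ 2 := by positivity
    rw [abs_le]
    constructor <;> nlinarith
  · have hx' := not_lt.1 hx
    have h1 : tp y S x = 0 := by
      apply bump_zero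
      nlinarith [le_abs_self S]
    have h2 : tp y S (x + z) = 0 := by
      apply bump_zero
      have : N - 1 ≤ ‖x + z - y‖ := by
        have := norm_sub_norm_le (x - y) (-z)
        rw [norm_neg, sub_neg_eq_add, show x - y + z = x + z - y by abel] at this
        linarith
      nlinarith [le_abs_self S]
    simp [Hj, hz, hx, Fj, bump, h1, h2]

lemma Fj_meas (y : Rd d) (S : ℝ) : Measurable (fun p : Rd d × Rd d => Fj y S p.1 p.2) := by
  have hb : Continuous (bump y S) := (bump_contDiff y S).continuous
  have ht := tp_cont y S
  unfold Fj
  refine Measurable.add ?_ (Measurable.ite ?_ ?_ measurable_const)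
  · exact Continuous.measurable (by fun_prop)
  · exact (isOpen_lt (continuous_norm.comp continuous_snd) continuous_const).measurableSet
  · exact Continuous.measurable (by fun_prop)

end Bump

/-! ### Part 4: the generator on bump functions -/

section Gen
variable {d m : ℕ} {Ω : Type} [MeasurableSpace Ω]

def Eloc (s : SJD d m Ω) (y x : Rd d) (i : Fin m) : ℝ :=
  3 * ∑ k, s.a x i k k + 6 * ∑ k, s.b x i k * (x - y) k

def Qloc (s : SJD d m Ω) (y x : Rd d) (i : Fin m) : ℝ :=
  ∑ k, ∑ l, (x - y) k * s.a x i k l * (x - y) l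

def Jj (s : SJD d m Ω) (y : Rd d) (S : ℝ) (x : Rd d) (i : Fin m) : ℝ :=
  ∫ z, Fj y S x z ∂(s.π x i)

def Loc (s : SJD d m Ω) (y : Rd d) (S : ℝ) (x : Rd d) (i : Fin m) : ℝ :=
  tp y S x * (12 * Qloc s y x i - tp y S x * Eloc s y x i)

lemma G_bump (s : SJD d m Ω) (y : Rd d) (S : ℝ) (c : Fin m → ℝ) (x : Rd d) (i : Fin m) :
    s.G (fun x j => c j * bump y S x) x i =
      c i * (Loc s y S x i + Jj s y S x i) + bump y S x * ∑ j, s.q x i j * c j := by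
  have hin : ∀ (w : Rd d) (k : Fin d), inner ℝ w (EuclideanSpace.single k (1 : ℝ)) = w k := by
    intro w k; simp [EuclideanSpace.inner_single_right]
  have h1 : (1 / 2) * ∑ k, ∑ l, s.a x i k l *
      iteratedFDeriv ℝ 2 (fun x => c i * bump y S x) x
        ![EuclideanSpace.single k (1 : ℝ), EuclideanSpace.single l (1 : ℝ)] =
      c i * (12 * tp y S x * Qloc s y x i - 3 * tp y S x ^ 2 * ∑ k, s.a x i k k) := by
    have e : ∀ k l, s.a x i k l * iteratedFDeriv ℝ 2 (fun x => c i * bump y S x) x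
        ![EuclideanSpace.single k (1 : ℝ), EuclideanSpace.single l (1 : ℝ)] =
        (24 * c i * tp y S x) * ((x - y) k * s.a x i k l * (x - y) l)
        - (6 * c i * tp y S x ^ 2) * (if k = l then s.a x i k l else 0) := by
      intro k l
      rw [bump_deriv2, hin, hin, hin]
      by_cases hkl : k = l
      · subst hkl
        simp
        ring
      · have : (EuclideanSpace.single k (1 : ℝ) : Rd d) l = 0 := by
          simp [Ne.symm hkl]
        rw [this, if_neg hkl]
        ring
    simp_rw [e, Finset.sum_sub_distrib, ← Finset.mul_sum, Qloc]
    simp only [Finset.sum_ite_eq, Finset.mem_univ, if_true]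
    ring
  have h2 : ∑ k, s.b x i k * fderiv ℝ (fun x => c i * bump y S x) x
      (EuclideanSpace.single k (1 : ℝ)) =
      c i * (-6 * tp y S x ^ 2 * ∑ k, s.b x i k * (x - y) k) := by
    rw [(bump_deriv y S (c i) x).fderiv]
    rw [Finset.mul_sum, Finset.mul_sum]
    refine Finset.sum_congr rfl fun k _ => ?_
    have := hin (x - y) k
    change s.b x i k * ((-6 * c i * tp y S x ^ 2) * inner ℝ (x - y) (EuclideanSpace.single k (1 : ℝ))) = _
    rw [this]
    ring
  have h3 : ∫ z, (c i * bump y S (x + z) - c i * bump y S x -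
        (if ‖z‖ < 1 then fderiv ℝ (fun x => c i * bump y S x) x z else 0)) ∂(s.π x i) =
        c i * Jj s y S x i := by
    rw [Jj, ← integral_const_mul]
    refine integral_congr_ae (Eventually.of_forall fun z => ?_)
    simp only [Fj]
    rw [(bump_deriv y S (c i) x).fderiv]
    split_ifs
    · change c i * bump y S (x + z) - c i * bump y S x - (-6 * c i * tp y S x ^ 2) * inner ℝ (x - y) z = _
      ring
    · ring
  have h4 : ∑ j, s.q x i j * (c j * bump y S x) = bump y S x * ∑ j, s.q x i j * c j := by
    rw [Finset.mul_sum]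
    exact Finset.sum_congr rfl fun j _ => by ring
  unfold SJD.G gen
  rw [h1, h2, h3, h4, Loc, Eloc]
  ring

lemma sjd_pi_def (s : SJD d m Ω) (x : Rd d) (i : Fin m) :
    s.π x i = volume.withDensity fun z => ENNReal.ofReal (s.pit x i z) := rfl

lemma Hj_meas (A B : ℝ) : Measurable (Hj (d := d) A B) := by
  unfold Hj
  refine Measurable.ite ?_ ?_ measurable_const
  · exact (isOpen_lt continuous_norm continuous_const).measurableSet
  · exact Continuous.measurable (by fun_prop)

lemma Hj_nonneg {A B : ℝ} (hA : 0 ≤ A) (hB : 0 ≤ B) (z : Rd d) : 0 ≤ Hj A B z := by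
  unfold Hj; split_ifs <;> positivity

lemma levy_bd (s : SJD d m Ω) : ∃ K : ℝ, 0 ≤ K ∧ ∀ x i (A B : ℝ), 0 ≤ A → 0 ≤ B →
    Integrable (Hj A B) (s.π x i) ∧
      ∫ z, Hj A B z ∂(s.π x i) ≤ K * (A * (1 + ‖x‖ ^ 2) + B) := by
  obtain ⟨c, hc, h1⟩ := s.smalljump
  obtain ⟨C, hC, h2⟩ := s.bigjump_bdd
  refine ⟨max c C.toReal, hc.le.trans (le_max_left _ _), fun x i A B hA hB => ?_⟩
  have hK0 : 0 ≤ max c C.toReal := hc.le.trans (le_max_left _ _)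
  have key : ∫⁻ z, ENNReal.ofReal (Hj A B z) ∂(s.π x i) ≤
      ENNReal.ofReal (max c C.toReal * (A * (1 + ‖x‖ ^ 2) + B)) := by
    rw [← lintegral_add_compl _ (measurableSet_ball (x := (0 : Rd d)) (ε := 1))]
    have e1 : ∫⁻ z in Metric.ball (0 : Rd d) 1, ENNReal.ofReal (Hj A B z) ∂(s.π x i) ≤
        ENNReal.ofReal (max c C.toReal * (A * (1 + ‖x‖ ^ 2))) := by
      calc _ = ∫⁻ z in Metric.ball (0 : Rd d) 1, ENNReal.ofReal A * ENNReal.ofReal (‖z‖ ^ 2) ∂(s.π x i) := by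
            refine setLIntegral_congr_fun measurableSet_ball fun z hz => ?_
            have hz' : ‖z‖ < 1 := by simpa using hz
            simp only [Hj, if_pos hz']
            rw [ENNReal.ofReal_mul hA]
        _ = ENNReal.ofReal A * ∫⁻ z in Metric.ball (0 : Rd d) 1, ENNReal.ofReal (‖z‖ ^ 2) ∂(s.π x i) :=
            lintegral_const_mul' _ _ ENNReal.ofReal_ne_top
        _ ≤ ENNReal.ofReal A * ENNReal.ofReal (c * (1 + ‖x‖ ^ 2)) := by
            gcongr; exact h1 x i
        _ ≤ _ := by
            rw [← ENNReal.ofReal_mul hA]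
            apply ENNReal.ofReal_le_ofReal
            have : c * (A * (1 + ‖x‖ ^ 2)) ≤ max c C.toReal * (A * (1 + ‖x‖ ^ 2)) :=
              mul_le_mul_of_nonneg_right (le_max_left _ _) (by positivity)
            linarith
    have e2 : ∫⁻ z in (Metric.ball (0 : Rd d) 1)ᶜ, ENNReal.ofReal (Hj A B z) ∂(s.π x i) ≤
        ENNReal.ofReal (max c C.toReal * B) := by
      calc _ = ∫⁻ z in (Metric.ball (0 : Rd d) 1)ᶜ, ENNReal.ofReal B ∂(s.π x i) := by
            refine setLIntegral_congr_fun measurableSet_ball.compl fun z hz => ?_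
            have hz' : ¬ ‖z‖ < 1 := by simpa using hz
            simp only [Hj, if_neg hz']
        _ = ENNReal.ofReal B * s.π x i (Metric.ball (0 : Rd d) 1)ᶜ := by
            rw [setLIntegral_const]
        _ ≤ ENNReal.ofReal B * C := by gcongr; exact h2 x i
        _ = ENNReal.ofReal B * ENNReal.ofReal C.toReal := by rw [ENNReal.ofReal_toReal hC.ne]
        _ ≤ _ := by
            rw [← ENNReal.ofReal_mul hB]
            apply ENNReal.ofReal_le_ofReal
            rw [mul_comm]
            exact mul_le_mul_of_nonneg_right (le_max_right _ _) hB
    refine (add_le_add e1 e2).trans ?_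
    rw [← ENNReal.ofReal_add (by positivity) (by positivity), mul_add (max c C.toReal)]
  have hI : Integrable (Hj A B) (s.π x i) := by
    refine ⟨(Hj_meas A B).aestronglyMeasurable, ?_⟩
    rw [hasFiniteIntegral_iff_ofReal (Eventually.of_forall fun z => Hj_nonneg hA hB z)]
    exact key.trans_lt ENNReal.ofReal_lt_top
  refine ⟨hI, ?_⟩
  rw [← ofReal_integral_eq_lintegral_ofReal hI
    (Eventually.of_forall fun z => Hj_nonneg hA hB z)] at key
  exact (ENNReal.ofReal_le_ofReal_iff (by positivity)).1 key

lemma Jj_lower (s : SJD d m Ω) : ∃ K : ℝ, 0 ≤ K ∧ ∀ (y : Rd d) S x i,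
    -(K * (3 * tp y S x ^ 2 * (1 + ‖x‖ ^ 2) + tp y S x ^ 3)) ≤ Jj s y S x i := by
  obtain ⟨K, hK, h⟩ := levy_bd s
  refine ⟨K, hK, fun y S x i => ?_⟩
  have ht := tp_nonneg y S x
  have hA : 0 ≤ 3 * tp y S x ^ 2 := by positivity
  have hB : 0 ≤ tp y S x ^ 3 := by positivity
  obtain ⟨hI, hb⟩ := h x i _ _ hA hB
  by_cases hF : Integrable (fun z => Fj y S x z) (s.π x i)
  · have := integral_mono hI.neg hF (fun z => Fj_lower y S x z)
    simp only [Pi.neg_apply, integral_neg] at this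
    unfold Jj
    linarith
  · unfold Jj
    rw [integral_undef hF, neg_nonpos]
    positivity

lemma Jj_bdd (s : SJD d m Ω) (y : Rd d) (S : ℝ) : ∃ C : ℝ, ∀ x i, |Jj s y S x i| ≤ C := by
  obtain ⟨K, hK, h⟩ := levy_bd s
  obtain ⟨A, B, hA, hB, hF⟩ := Fj_upper y S
  refine ⟨K * (A * (1 + (‖y‖ + (|S| + 2)) ^ 2) + B), fun x i => ?_⟩
  have hA' : 0 ≤ (if ‖x - y‖ < |S| + 2 then A else 0) := by split_ifs <;> simp [hA]
  obtain ⟨hI, hb⟩ := h x i _ _ hA' hB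
  have h1 := norm_integral_le_of_norm_le (f := Fj y S x) hI (Eventually.of_forall fun z => hF x z)
  refine h1.trans (hb.trans (mul_le_mul_of_nonneg_left (add_le_add ?_ le_rfl) hK))
  split_ifs with hx
  · gcongr
    have := norm_add_le (x - y) y
    rw [sub_add_cancel] at this
    linarith
  · rw [zero_mul]; positivity

lemma Jj_meas (s : SJD d m Ω) (y : Rd d) (S : ℝ) (i : Fin m) :
    Measurable (fun x => Jj s y S x i) := by
  have e : (fun x => Jj s y S x i) = fun x => ∫ z, s.pit x i z * Fj y S x z := by
    funext x
    rw [Jj, sjd_pi_def, integral_withDensity_eq_integral_toReal_smul]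
    · refine integral_congr_ae (Eventually.of_forall fun z => ?_)
      simp [ENNReal.toReal_ofReal (s.pit_nonneg x i z)]
    · exact ((s.pit_meas i).comp measurable_prodMk_left).ennreal_ofReal
    · exact Eventually.of_forall fun z => ENNReal.ofReal_lt_top
  rw [e]
  have hm : Measurable (fun p : Rd d × Rd d => s.pit p.1 i p.2 * Fj y S p.1 p.2) :=
    (s.pit_meas i).mul (Fj_meas y S)
  exact (StronglyMeasurable.integral_prod_right' hm.stronglyMeasurable).measurable

lemma a_cont (s : SJD d m Ω) (i : Fin m) : Continuous (fun x => s.a x i) := by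
  have := s.sig_cont i
  unfold SJD.a
  fun_prop

lemma Eloc_cont (s : SJD d m Ω) (y : Rd d) (i : Fin m) : Continuous (fun x => Eloc s y x i) := by
  have h1 := a_cont s i
  have h2 := s.b_cont i
  have h1' : ∀ k l, Continuous (fun x => s.a x i k l) := fun k l => by fun_prop
  have h2' : ∀ k, Continuous (fun x => s.b x i k) := fun k => by fun_prop
  unfold Eloc
  refine (continuous_const.mul (continuous_finsetSum _ fun k _ => h1' k k)).add
    (continuous_const.mul (continuous_finsetSum _ fun k _ => (h2' k).mul (by fun_prop)))

lemma Loc_cont (s : SJD d m Ω) (y : Rd d) (S : ℝ) (i : Fin m) :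
    Continuous (fun x => Loc s y S x i) := by
  have h1 := a_cont s i
  have h1' : ∀ k l, Continuous (fun x => s.a x i k l) := fun k l => by fun_prop
  have h2 := Eloc_cont s y i
  have h3 : Continuous (fun x => Qloc s y x i) := by
    unfold Qloc
    refine continuous_finsetSum _ fun k _ => continuous_finsetSum _ fun l _ => ?_
    exact ((by fun_prop : Continuous fun x : Rd d => (x - y) k).mul (h1' k l)).mul (by fun_prop)
  have h4 := tp_cont y S
  unfold Loc
  fun_prop

lemma L_bdd (s : SJD d m Ω) (y : Rd d) (S : ℝ) :
    ∃ C : ℝ, ∀ x i, |Loc s y S x i + Jj s y S x i| ≤ C := by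
  obtain ⟨C1, h1⟩ := Jj_bdd s y S
  have h2 : ∀ i, ∃ C, ∀ x, ‖Loc s y S x i‖ ≤ C := fun i => by
    refine (Loc_cont s y S i).bounded_above_of_compact_support ?_
    exact (tp_cpt y S).mul_right
  choose C2 h2 using h2
  refine ⟨∑ i, |C2 i| + C1, fun x i => (abs_add_le _ _).trans (add_le_add ?_ (h1 x i))⟩
  refine (h2 i x).trans ((le_abs_self _).trans ?_)
  exact Finset.single_le_sum (f := fun i => |C2 i|) (fun j _ => abs_nonneg _) (Finset.mem_univ i)

lemma L_meas (s : SJD d m Ω) (y : Rd d) (S : ℝ) (i : Fin m) :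
    Measurable (fun x => Loc s y S x i + Jj s y S x i) :=
  (Loc_cont s y S i).measurable.add (Jj_meas s y S i)

lemma L_nonneg (s : SJD d m Ω) (y : Rd d) (S : ℝ) (x : Rd d) (i : Fin m)
    (h : S ≤ ‖x - y‖ ^ 2) : 0 ≤ Loc s y S x i + Jj s y S x i := by
  obtain ⟨K, hK, hJ⟩ := Jj_lower s
  have h1 := hJ y S x i
  have h0 := bump_zero y S x h
  rw [h0] at h1
  simp [Loc, h0]
  simpa using h1

lemma L_pos (s : SJD d m Ω) (y : Rd d) (S : ℝ) (hS : 0 < S) :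
    ∃ S' > S, ∀ x i, S ≤ ‖x - y‖ ^ 2 → ‖x - y‖ ^ 2 < S' →
      0 < Loc s y S' x i + Jj s y S' x i := by
  obtain ⟨K, hK, hJ⟩ := Jj_lower s
  obtain ⟨κ, hκ, hell⟩ := s.ellipticity (Metric.closedBall y (S + 1)) Metric.isBounded_closedBall
  have hE : ∀ i, ∃ C, ∀ x ∈ Metric.closedBall y (S + 1), ‖Eloc s y x i‖ ≤ C := fun i =>
    (isCompact_closedBall y (S + 1)).exists_bound_of_continuousOn (Eloc_cont s y i).continuousOn
  choose CE hCE using hE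
  set D := ∑ i, |CE i| with hD
  have hD0 : 0 ≤ D := Finset.sum_nonneg fun i _ => abs_nonneg _
  set M := (‖y‖ + (S + 1)) ^ 2 with hM
  have hM0 : 0 ≤ M := sq_nonneg _
  set T := D + K * (3 * (1 + M) + 1) with hT
  have hT0 : 0 ≤ T := by positivity
  have hκ0 := hκ.1
  set ε := min 1 (κ * S / (T + 1)) with hε
  have hε0 : 0 < ε := by positivity
  have hε1 : ε ≤ 1 := min_le_left _ _
  have hε2 : ε * T ≤ κ * S := by
    have : ε ≤ κ * S / (T + 1) := min_le_right _ _
    rw [le_div_iff₀ (by positivity)] at this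
    nlinarith
  refine ⟨S + ε, by linarith, fun x i hx1 hx2 => ?_⟩
  have htx : tp y (S + ε) x = S + ε - ‖x - y‖ ^ 2 := max_eq_left (by linarith)
  set t := tp y (S + ε) x with ht
  have ht0 : 0 < t := by rw [htx]; linarith
  have ht1 : t ≤ ε := by rw [htx]; linarith
  have hn := norm_nonneg (x - y)
  have hxb : x ∈ Metric.closedBall y (S + 1) := by
    rw [mem_closedBall, dist_eq_norm]
    nlinarith
  have hq := (hell x hxb i (x - y)).1
  have hq' : κ * S ≤ Qloc s y x i := (mul_le_mul_of_nonneg_left hx1 hκ0.le).trans hq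
  have hEx : Eloc s y x i ≤ D := by
    refine (le_abs_self _).trans ((hCE i x hxb).trans ((le_abs_self _).trans ?_))
    exact Finset.single_le_sum (f := fun i => |CE i|) (fun j _ => abs_nonneg _) (Finset.mem_univ i)
  have hxM : ‖x‖ ^ 2 ≤ M := by
    refine pow_le_pow_left₀ (norm_nonneg _) ?_ 2
    have h1 := norm_add_le (x - y) y
    rw [sub_add_cancel] at h1
    rw [mem_closedBall, dist_eq_norm] at hxb
    linarith
  have hj := hJ y (S + ε) x i
  rw [← ht] at hj
  have hj2 : K * (3 * t ^ 2 * (1 + ‖x‖ ^ 2) + t ^ 3) ≤ t ^ 2 * (K * (3 * (1 + M) + 1)) := by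
    have a1 : 3 * t ^ 2 * (1 + ‖x‖ ^ 2) ≤ 3 * t ^ 2 * (1 + M) := by gcongr
    have a2 : t ^ 3 ≤ t ^ 2 := pow_le_pow_of_le_one ht0.le (by linarith) (by norm_num)
    have a3 := mul_le_mul_of_nonneg_left (add_le_add a1 a2) hK
    nlinarith
  have hl : Loc s y (S + ε) x i = t * (12 * Qloc s y x i - t * Eloc s y x i) := rfl
  have b1 : t * (t * Eloc s y x i) ≤ t * (t * D) := by gcongr
  have b2 : t * (κ * S) ≤ t * Qloc s y x i := by gcongr
  have b3 : t * (t * T) ≤ t * (κ * S) := by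
    refine mul_le_mul_of_nonneg_left ?_ ht0.le
    exact (mul_le_mul_of_nonneg_right ht1 hT0).trans hε2
  have b4 : 0 < t * (κ * S) := by positivity
  have b5 : t * (t * T) = t * (t * D) + t ^ 2 * (K * (3 * (1 + M) + 1)) := by rw [hT]; ring
  rw [hl]
  nlinarith

end Gen

/-! ### Part 5: propagation of null sets -/

section Prop5
variable {d m : ℕ} {Ω : Type} [MeasurableSpace Ω]

lemma G_ae_zero (s : SJD d m Ω)
    (ν : Measure (Rd d × Fin m)) (hν : IsProbabilityMeasure ν)
    (hinv : ∀ f : Rd d × Fin m → ℝ, Measurable f → (∃ C : ℝ, ∀ p, |f p| ≤ C) →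
      ∀ t : ℝ≥0,
        ∫ p, (∫ ω, f (s.Z t ω) ∂(s.P p.1 p.2)) ∂ν = ∫ p, f p ∂ν)
    (y : Rd d) (S : ℝ) (c : Fin m → ℝ)
    (h : ∀ᵐ p ∂ν, 0 ≤ c p.2 * (Loc s y S p.1 p.2 + Jj s y S p.1 p.2)
      + bump y S p.1 * ∑ j, s.q p.1 p.2 j * c j) :
    ∀ᵐ p ∂ν, c p.2 * (Loc s y S p.1 p.2 + Jj s y S p.1 p.2)
      + bump y S p.1 * ∑ j, s.q p.1 p.2 j * c j = 0 := by
  have hbc : Continuous (bump y S) := (bump_contDiff y S).continuous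
  have hbb : ∀ x, |bump y S x| ≤ |S| ^ 3 := fun x => by
    rw [bump, abs_of_nonneg (pow_nonneg (tp_nonneg y S x) 3)]
    exact pow_le_pow_left₀ (tp_nonneg y S x) (tp_le y S x) 3
  obtain ⟨C, hC⟩ := L_bdd s y S
  choose Cq hCq using s.q_bdd
  have hGm : Measurable fun p : Rd d × Fin m => s.G (fun x j => c j * bump y S x) p.1 p.2 := by
    simp_rw [G_bump]
    refine measurable_from_prod_countable_left fun i => ?_
    change Measurable (fun x => c i * (Loc s y S x i + Jj s y S x i)
      + bump y S x * ∑ j, s.q x i j * c j)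
    refine ((L_meas s y S i).const_mul (c i)).add (hbc.measurable.mul ?_)
    exact Finset.measurable_sum _ fun j _ => (s.q_meas i j).mul_const _
  have hGb : ∀ x i, |s.G (fun x j => c j * bump y S x) x i| ≤
      (∑ i, |c i|) * C + |S| ^ 3 * ∑ i, ∑ j, |Cq i j| * |c j| := by
    intro x i
    rw [G_bump]
    have hC0 : 0 ≤ C := (abs_nonneg _).trans (hC x i)
    refine (abs_add_le _ _).trans (add_le_add ?_ ?_)
    · rw [abs_mul]
      refine mul_le_mul ?_ (hC x i) (abs_nonneg _) (Finset.sum_nonneg fun j _ => abs_nonneg _)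
      exact Finset.single_le_sum (f := fun i => |c i|) (fun j _ => abs_nonneg _) (Finset.mem_univ i)
    · rw [abs_mul]
      refine mul_le_mul (hbb x) ?_ (abs_nonneg _) (by positivity)
      refine le_trans ?_ (Finset.single_le_sum (f := fun i => ∑ j, |Cq i j| * |c j|)
        (fun j _ => Finset.sum_nonneg fun k _ => by positivity) (Finset.mem_univ i))
      refine (Finset.abs_sum_le_sum_abs _ _).trans (Finset.sum_le_sum fun j _ => ?_)
      rw [abs_mul]
      exact mul_le_mul_of_nonneg_right ((hCq i j x).trans (le_abs_self _)) (abs_nonneg _)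
  have hK : ∀ x i, |c i * bump y S x| ≤ (∑ i, |c i|) * |S| ^ 3 := by
    intro x i
    rw [abs_mul]
    refine mul_le_mul ?_ (hbb x) (abs_nonneg _) (Finset.sum_nonneg fun j _ => abs_nonneg _)
    exact Finset.single_le_sum (f := fun i => |c i|) (fun j _ => abs_nonneg _) (Finset.mem_univ i)
  have hfm : Measurable fun p : Rd d × Fin m => c p.2 * bump y S p.1 := by
    refine measurable_from_prod_countable_left fun i => ?_
    change Measurable (fun x => c i * bump y S x)
    exact hbc.measurable.const_mul (c i)
  obtain ⟨hi, hz⟩ := int_G_zero s ν hν hinv (fun x j => c j * bump y S x)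
    (fun i => contDiff_const.mul (bump_contDiff y S)) (fun i => bump_bdds y S (c i))
    _ hK hfm hGm _ hGb
  simp_rw [G_bump] at hi hz
  exact (integral_eq_zero_iff_of_nonneg_ae h hi).1 hz

lemma expand_step (s : SJD d m Ω)
    (ν : Measure (Rd d × Fin m)) (hν : IsProbabilityMeasure ν)
    (hinv : ∀ f : Rd d × Fin m → ℝ, Measurable f → (∃ C : ℝ, ∀ p, |f p| ≤ C) →
      ∀ t : ℝ≥0,
        ∫ p, (∫ ω, f (s.Z t ω) ∂(s.P p.1 p.2)) ∂ν = ∫ p, f p ∂ν)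
    (y : Rd d) (S : ℝ) (hS : 0 < S) (h : ∀ᵐ p ∂ν, S ≤ ‖p.1 - y‖ ^ 2) :
    ∃ S' > S, ∀ᵐ p ∂ν, S' ≤ ‖p.1 - y‖ ^ 2 := by
  obtain ⟨S', hS', hpos⟩ := L_pos s y S hS
  refine ⟨S', hS', ?_⟩
  have key := G_ae_zero s ν hν hinv y S' (fun _ => 1) ?_
  · filter_upwards [key, h] with p hp1 hp2
    by_contra hlt
    have := hpos p.1 p.2 hp2 (not_le.1 hlt)
    simp [s.q_rowsum] at hp1
    linarith
  · filter_upwards [h] with p hp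
    simp only [one_mul, mul_one, s.q_rowsum, mul_zero, add_zero]
    rcases lt_or_ge (‖p.1 - y‖ ^ 2) S' with h1 | h1
    · exact (hpos p.1 p.2 hp h1).le
    · exact L_nonneg s y S' p.1 p.2 h1

lemma switch_step (s : SJD d m Ω) (hirr : s.StrictIrredAll)
    (ν : Measure (Rd d × Fin m)) (hν : IsProbabilityMeasure ν)
    (hinv : ∀ f : Rd d × Fin m → ℝ, Measurable f → (∃ C : ℝ, ∀ p, |f p| ≤ C) →
      ∀ t : ℝ≥0,
        ∫ p, (∫ ω, f (s.Z t ω) ∂(s.P p.1 p.2)) ∂ν = ∫ p, f p ∂ν)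
    (D : Set (Rd d)) (hD : BddDomain D) (l : Fin m)
    (hnull : ν (D ×ˢ ({l} : Set (Fin m))) = 0)
    (y : Rd d) (r : ℝ) (hr : 0 < r) (hrD : Metric.ball y r ⊆ D) :
    ∀ᵐ p ∂ν, r ^ 2 ≤ ‖p.1 - y‖ ^ 2 := by
  have h0 : ∀ᵐ p ∂ν, p ∉ D ×ˢ ({l} : Set (Fin m)) := measure_eq_zero_iff_ae_notMem.1 hnull
  have hout : ∀ x : Rd d, x ∉ D → r ^ 2 ≤ ‖x - y‖ ^ 2 := by
    intro x hx
    refine pow_le_pow_left₀ hr.le ?_ 2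
    by_contra hlt
    apply hx
    apply hrD
    rw [mem_ball, dist_eq_norm]
    exact not_le.1 hlt
  have hsum : ∀ x i, ∑ j, s.q x i j * (Pi.single l (1 : ℝ) : Fin m → ℝ) j = s.q x i l := by
    intro x i
    simp [Pi.single_apply]
  have key := G_ae_zero s ν hν hinv y (r ^ 2) (Pi.single l (1 : ℝ)) ?_
  · filter_upwards [key, h0] with p hp1 hp2
    by_cases hl : p.2 = l
    · exact hout _ fun hx => hp2 ⟨hx, hl⟩
    · by_contra hlt
      rw [hsum, Pi.single_eq_of_ne hl, zero_mul, zero_add] at hp1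
      have hxD : p.1 ∈ D := by
        by_contra hx
        exact hlt (hout _ hx)
      obtain ⟨q0, hq0, hq⟩ := hirr D hD p.2 l hl
      have h1 : 0 < tp y (r ^ 2) p.1 := lt_max_of_lt_left (by linarith [not_le.1 hlt])
      have h2 : 0 < bump y (r ^ 2) p.1 := pow_pos h1 3
      have h3 := mul_pos h2 (hq0.trans_le (hq p.1 hxD))
      linarith
  · filter_upwards [h0] with p hp2
    rw [hsum]
    by_cases hl : p.2 = l
    · have hx := hout _ fun hx => hp2 ⟨hx, hl⟩
      have hb : bump y (r ^ 2) p.1 = 0 := by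
        rw [bump, bump_zero y _ _ hx]; simp
      rw [hb, zero_mul, add_zero, hl, Pi.single_eq_same, one_mul]
      exact L_nonneg s y _ _ _ hx
    · rw [Pi.single_eq_of_ne hl, zero_mul, zero_add]
      exact mul_nonneg (pow_nonneg (tp_nonneg _ _ _) 3) (s.q_nonneg _ _ _ hl)

end Prop5


lemma sup_arg {α : Type*} [MeasurableSpace α] (ν : Measure α) [IsProbabilityMeasure ν]
    (φ : α → ℝ) (R : ℝ) (hR : 0 < R) (h0 : ∀ᵐ p ∂ν, R ≤ φ p)
    (hstep : ∀ S : ℝ, 0 < S → (∀ᵐ p ∂ν, S ≤ φ p) → ∃ S' > S, ∀ᵐ p ∂ν, S' ≤ φ p) : False := by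
  by_cases hbdd : ∃ B : ℝ, ∀ S : ℝ, (∀ᵐ p ∂ν, S ≤ φ p) → S ≤ B
  · obtain ⟨B, hB⟩ := hbdd
    obtain ⟨T, hT⟩ : ∃ T, IsLUB {S : ℝ | ∀ᵐ p ∂ν, S ≤ φ p} T :=
      Real.exists_isLUB ⟨R, h0⟩ ⟨B, fun S hS => hB S hS⟩
    have hTpos : 0 < T := hR.trans_le (hT.1 h0)
    have h1 : ∀ n : ℕ, ∀ᵐ p ∂ν, T - 1 / ((n : ℝ) + 1) ≤ φ p := by
      intro n
      have hn : T - 1 / ((n : ℝ) + 1) < T := by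
        have : 0 < 1 / ((n : ℝ) + 1) := by positivity
        linarith
      obtain ⟨S, hS, hn⟩ := (lt_isLUB_iff hT).1 hn
      have hS' : ∀ᵐ p ∂ν, S ≤ φ p := hS
      filter_upwards [hS'] with p hp
      linarith
    have h2 : ∀ᵐ p ∂ν, T ≤ φ p := by
      filter_upwards [ae_all_iff.2 h1] with p hp
      refine le_of_forall_pos_le_add fun ε hε => ?_
      obtain ⟨n, hn⟩ := exists_nat_one_div_lt hε
      have := hp n
      linarith
    obtain ⟨S', hS', hS'A⟩ := hstep T hTpos h2
    exact absurd (hT.1 hS'A) (not_le.2 hS')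
  · push Not at hbdd
    have h1 : ∀ n : ℕ, ∀ᵐ p ∂ν, (n : ℝ) ≤ φ p := by
      intro n
      obtain ⟨S, hS, hn⟩ := hbdd n
      filter_upwards [hS] with p hp
      linarith
    have h2 : ∀ᵐ p ∂ν, False := by
      filter_upwards [ae_all_iff.2 h1] with p hp
      obtain ⟨n, hn⟩ := exists_nat_gt (φ p)
      have := hp n
      linarith
    exact h2.exists.elim fun _ h => h
/-- **Proposition 4.5.** Suppose `G` is strictly irreducible on every bounded domain and
condition (C1) holds with respect to some bounded domain times `M`. If `ν̃` is an invariant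
probability measure of `(X(t),Λ(t))`, then `ν̃(D × {l}) > 0` for every bounded domain
`D ⊆ ℝ^d` and every `l ∈ M`. -/
theorem invariant_measure_positive_on_domains {d m : ℕ} {Ω : Type} [MeasurableSpace Ω]
    (hd : 1 ≤ d) (hm : 1 ≤ m) (s : SJD d m Ω)
    (hirr : s.StrictIrredAll)
    (hC1 : ∃ D : Set (Rd d), BddDomain D ∧ s.C1 D)
    (ν : Measure (Rd d × Fin m)) (hν : IsProbabilityMeasure ν)
    (hinv : ∀ f : Rd d × Fin m → ℝ, Measurable f → (∃ C : ℝ, ∀ p, |f p| ≤ C) →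
      ∀ t : ℝ≥0,
        ∫ p, (∫ ω, f (s.Z t ω) ∂(s.P p.1 p.2)) ∂ν = ∫ p, f p ∂ν) :
    ∀ D : Set (Rd d), BddDomain D → ∀ l : Fin m,
      0 < ν (D ×ˢ ({l} : Set (Fin m))) := by
  intro D hD l
  by_contra hpos
  have hnull : ν (D ×ˢ ({l} : Set (Fin m))) = 0 := by
    simpa using hpos
  obtain ⟨y, hy⟩ := hD.2.1.nonempty
  obtain ⟨r, hr, hrD⟩ := Metric.isOpen_iff.1 hD.1 y hy
  have h0 := switch_step s hirr ν hν hinv D hD l hnull y r hr hrD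
  exact sup_arg ν (fun p => ‖p.1 - y‖ ^ 2) (r ^ 2) (pow_pos hr 2) h0
    (fun S hS h => expand_step s ν hν hinv y S hS h)
end
end

section
/- Let d = 1. Suppose the operator G is strictly irreducible on every bounded domain of ℝ and that ∫_{|z|≥1} |z| π̃_i(x,z) dz < ∞ for all (x,i). Define A(x,i) = b(x,i) + ∫_{1<|z|≤|x|} z π̃_i(x,z) dz and B(x,i) = ∫_{|z|>|x|} |z| π̃_i(x,z) dz. If limsup_{|x|→∞} [A(x,i)·sgn(x) + B(x,i)] < 0 for each i ∈ M, then the process (X(t),Λ(t)) is positive recurrent (with respect to some bounded domain times M, condition (C1) being satisfied). -/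
open MeasureTheory Set Filter Metric Matrix
open scoped NNReal ENNReal Topology

noncomputable section

/-- smooth substitute for the absolute value -/
def hfun (y : ℝ) : ℝ := y * (Real.smoothTransition y - Real.smoothTransition (-y))

lemma hfun_contDiff : ContDiff ℝ 2 hfun := by
  have h : ContDiff ℝ 2 Real.smoothTransition := Real.smoothTransition.contDiff (n := 2)
  unfold hfun
  exact contDiff_id.mul (h.sub (h.comp contDiff_neg))

lemma hfun_of_nonneg {y : ℝ} (hy : 0 ≤ y) : hfun y = y * Real.smoothTransition y := by
  unfold hfun
  rw [Real.smoothTransition.zero_of_nonpos (x := -y) (by linarith)]; ring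

lemma hfun_of_nonpos {y : ℝ} (hy : y ≤ 0) : hfun y = (-y) * Real.smoothTransition (-y) := by
  unfold hfun
  rw [Real.smoothTransition.zero_of_nonpos (x := y) (by linarith)]; ring

lemma hfun_nonneg (y : ℝ) : 0 ≤ hfun y := by
  rcases le_total 0 y with h | h
  · rw [hfun_of_nonneg h]; exact mul_nonneg h (Real.smoothTransition.nonneg _)
  · rw [hfun_of_nonpos h]; exact mul_nonneg (by linarith) (Real.smoothTransition.nonneg _)

lemma hfun_le_abs (y : ℝ) : hfun y ≤ |y| := by
  rcases le_total 0 y with h | h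
  · rw [hfun_of_nonneg h, abs_of_nonneg h]
    exact mul_le_of_le_one_right h (Real.smoothTransition.le_one _)
  · rw [hfun_of_nonpos h, abs_of_nonpos h]
    exact mul_le_of_le_one_right (by linarith) (Real.smoothTransition.le_one _)

lemma hfun_eq_abs {y : ℝ} (hy : 1 ≤ |y|) : hfun y = |y| := by
  rcases le_total 0 y with h | h
  · rw [abs_of_nonneg h] at hy
    rw [hfun_of_nonneg h, abs_of_nonneg h, Real.smoothTransition.one_of_one_le hy, mul_one]
  · rw [abs_of_nonpos h] at hy
    rw [hfun_of_nonpos h, abs_of_nonpos h, Real.smoothTransition.one_of_one_le hy, mul_one]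

/-- derivative of the truncation -/
def gtr (N t : ℝ) : ℝ := 1 - Real.smoothTransition (t - N)
/-- concave truncation -/
def phitr (N v : ℝ) : ℝ := ∫ t in (0:ℝ)..v, gtr N t

lemma gtr_contDiff (N : ℝ) : ContDiff ℝ 1 (gtr N) := by
  have h : ContDiff ℝ 1 Real.smoothTransition := Real.smoothTransition.contDiff (n := 1)
  unfold gtr
  exact contDiff_const.sub (h.comp (contDiff_id.sub contDiff_const))

lemma gtr_antitone (N : ℝ) : Antitone (gtr N) := by
  intro a b hab
  have := Real.smoothTransition.monotone (sub_le_sub_right hab N)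
  unfold gtr; linarith

lemma gtr_nonneg (N t : ℝ) : 0 ≤ gtr N t := by
  have := Real.smoothTransition.le_one (t - N)
  unfold gtr; linarith

lemma gtr_le_one (N t : ℝ) : gtr N t ≤ 1 := by
  have := Real.smoothTransition.nonneg (t - N)
  unfold gtr; linarith

lemma gtr_one {N t : ℝ} (h : t ≤ N) : gtr N t = 1 := by
  unfold gtr; rw [Real.smoothTransition.zero_of_nonpos (by linarith)]; ring

lemma gtr_zero {N t : ℝ} (h : N + 1 ≤ t) : gtr N t = 0 := by
  unfold gtr; rw [Real.smoothTransition.one_of_one_le (by linarith)]; ring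

lemma phitr_deriv (N v : ℝ) : HasDerivAt (phitr N) (gtr N v) v :=
  intervalIntegral.integral_hasDerivAt_right
    ((gtr_contDiff N).continuous.intervalIntegrable _ _)
    ((gtr_contDiff N).continuous.stronglyMeasurableAtFilter _ _)
    (gtr_contDiff N).continuous.continuousAt

lemma phitr_contDiff (N : ℝ) : ContDiff ℝ 2 (phitr N) := by
  have : (2 : WithTop ℕ∞) = 1 + 1 := by norm_num
  rw [this, contDiff_succ_iff_deriv]
  refine ⟨fun v => (phitr_deriv N v).differentiableAt, by simp, ?_⟩
  have : deriv (phitr N) = gtr N := funext fun v => (phitr_deriv N v).deriv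
  rw [this]; exact gtr_contDiff N

lemma phitr_nonneg (N : ℝ) {v : ℝ} (hv : 0 ≤ v) : 0 ≤ phitr N v :=
  intervalIntegral.integral_nonneg hv fun t _ => gtr_nonneg N t

lemma phitr_le (N : ℝ) {v : ℝ} (hv : 0 ≤ v) : phitr N v ≤ v := by
  have := intervalIntegral.integral_mono (μ := volume) hv
    ((gtr_contDiff N).continuous.intervalIntegrable 0 v)
    (continuous_const.intervalIntegrable 0 v) (fun t => gtr_le_one N t)
  simpa [phitr] using this

lemma phitr_const (N : ℝ) {v : ℝ} (hv : N + 1 ≤ v) : phitr N v = phitr N (N + 1) := by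
  unfold phitr
  rw [← sub_eq_zero, intervalIntegral.integral_interval_sub_left
    ((gtr_contDiff N).continuous.intervalIntegrable _ _)
    ((gtr_contDiff N).continuous.intervalIntegrable _ _)]
  apply intervalIntegral.integral_zero_ae
  refine Filter.Eventually.of_forall fun t ht => ?_
  rw [uIoc_of_le hv] at ht
  exact gtr_zero ht.1.le

lemma tangent_le {φ g : ℝ → ℝ} (hd : ∀ v, HasDerivAt φ (g v) v) (hg : Antitone g) (v w : ℝ) :
    φ w ≤ φ v + g v * (w - v) := by
  rcases lt_trichotomy v w with h | h | h
  · obtain ⟨c, hc, hc'⟩ := exists_hasDerivAt_eq_slope φ g h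
      (fun x _ => (hd x).continuousAt.continuousWithinAt) (fun x _ => hd x)
    rw [eq_div_iff (by linarith)] at hc'
    have := hg hc.1.le
    nlinarith
  · subst h; simp
  · obtain ⟨c, hc, hc'⟩ := exists_hasDerivAt_eq_slope φ g h
      (fun x _ => (hd x).continuousAt.continuousWithinAt) (fun x _ => hd x)
    rw [eq_div_iff (by linarith)] at hc'
    have := hg hc.2.le
    nlinarith

lemma bdd_of_cont {u : ℝ → ℝ} (hu : Continuous u) {L c : ℝ} (h : ∀ y, L < |y| → |u y| ≤ c) :
    ∃ C, ∀ y, |u y| ≤ C := by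
  obtain ⟨C, hC⟩ := (isCompact_closedBall (0:ℝ) L).exists_bound_of_continuousOn hu.continuousOn
  refine ⟨max C c, fun y => ?_⟩
  rcases lt_or_ge L |y| with hy | hy
  · exact (h y hy).trans (le_max_right _ _)
  · exact (hC y (by simpa using hy)).trans (le_max_left _ _)

lemma iter2 (F : ℝ → ℝ) : iteratedDeriv 2 F = deriv (deriv F) := by
  rw [iteratedDeriv_succ, iteratedDeriv_one]

lemma taylor_bd {F : ℝ → ℝ} (hF : ContDiff ℝ 2 F) {C : ℝ} (hC : ∀ y, |iteratedDeriv 2 F y| ≤ C)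
    (x z : ℝ) : |F (x + z) - F x - deriv F x * z| ≤ C * z ^ 2 := by
  have hF1 : ∀ y, HasDerivAt F (deriv F y) y := fun y =>
    (hF.differentiable (by norm_num) y).hasDerivAt
  have hF2 : ∀ y, HasDerivAt (deriv F) (iteratedDeriv 2 F y) y := fun y => by
    rw [iter2]
    have : ContDiff ℝ 1 (deriv F) := by
      have h2 : (2 : WithTop ℕ∞) = 1 + 1 := by norm_num
      rw [h2, contDiff_succ_iff_deriv] at hF
      exact hF.2.2
    exact (this.differentiable (by norm_num) y).hasDerivAt
  have hC0 : 0 ≤ C := (abs_nonneg _).trans (hC 0)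
  have hlip : ∀ y, |deriv F y - deriv F x| ≤ C * |y - x| := fun y =>
    Convex.norm_image_sub_le_of_norm_hasDerivWithin_le (s := univ)
      (fun y _ => (hF2 y).hasDerivWithinAt) (fun y _ => hC y) convex_univ (mem_univ x) (mem_univ y)
  have key := Convex.norm_image_sub_le_of_norm_hasDerivWithin_le (s := closedBall x |z|)
    (f := fun y => F y - deriv F x * y) (f' := fun y => deriv F y - deriv F x) (C := C * |z|)
    (x := x) (y := x + z)
    (fun y _ => by
      have h : HasDerivAt (fun y => F y - deriv F x * y) (deriv F y - deriv F x * 1) y :=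
        (hF1 y).sub ((hasDerivAt_id y).const_mul (deriv F x))
      rw [mul_one] at h
      exact h.hasDerivWithinAt)
    (fun y hy => (hlip y).trans (mul_le_mul_of_nonneg_left (by simpa [Real.dist_eq] using hy) hC0))
    (convex_closedBall _ _) (by simp) (by simp)
  simp only [Real.norm_eq_abs, add_sub_cancel_left] at key
  have e : C * |z| * |z| = C * z ^ 2 := by rw [mul_assoc, abs_mul_abs_self]; ring
  rw [e] at key
  convert key using 2; ring

lemma lip_bd {F : ℝ → ℝ} (hF : ContDiff ℝ 2 F) {C : ℝ} (hC : ∀ y, |deriv F y| ≤ C)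
    (x z : ℝ) : |F (x + z) - F x| ≤ C * |z| := by
  have := Convex.norm_image_sub_le_of_norm_hasDerivWithin_le (s := univ) (f := F)
      (fun y _ => (hF.differentiable (by norm_num) y).hasDerivAt.hasDerivWithinAt)
      (fun y _ => hC y) convex_univ (mem_univ x) (mem_univ (x + z))
  simpa using this

lemma contDiff2_deriv {F : ℝ → ℝ} (hF : ContDiff ℝ 2 F) : ContDiff ℝ 1 (deriv F) := by
  have h2 : (2 : WithTop ℕ∞) = 1 + 1 := by norm_num
  rw [h2, contDiff_succ_iff_deriv] at hF
  exact hF.2.2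

lemma contDiff2_cont {F : ℝ → ℝ} (hF : ContDiff ℝ 2 F) : Continuous (iteratedDeriv 2 F) := by
  rw [iter2]; exact (contDiff2_deriv hF).continuous_deriv (by norm_num)

/-- composition -/
def Fc (φ : ℝ → ℝ) (K y : ℝ) : ℝ := φ (K * hfun y)

lemma Fc_contDiff {φ : ℝ → ℝ} (h : ContDiff ℝ 2 φ) (K : ℝ) : ContDiff ℝ 2 (Fc φ K) :=
  h.comp (contDiff_const.mul hfun_contDiff)

lemma sign_mul_abs' (y : ℝ) : y * Real.sign y = |y| := by
  rcases lt_trichotomy y 0 with h | h | h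
  · rw [Real.sign_of_neg h, abs_of_neg h]; ring
  · subst h; simp
  · rw [Real.sign_of_pos h, abs_of_pos h]; ring

lemma hfun_ev {x : ℝ} (hx : 1 < |x|) : ∀ᶠ y in 𝓝 x, hfun y = Real.sign x * y := by
  have h1 : ∀ᶠ y in 𝓝 x, 1 < |y| := continuous_abs.continuousAt.eventually (lt_mem_nhds hx)
  have hx0 : x ≠ 0 := by rintro rfl; simp at hx; linarith
  rcases lt_or_gt_of_ne hx0 with h | h
  · filter_upwards [h1, gt_mem_nhds h] with y hy1 hy
    rw [hfun_eq_abs hy1.le, Real.sign_of_neg h, abs_of_neg hy]; ring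
  · filter_upwards [h1, lt_mem_nhds h] with y hy1 hy
    rw [hfun_eq_abs hy1.le, Real.sign_of_pos h, abs_of_pos hy]; ring

lemma Fc_deriv {φ g : ℝ → ℝ} (hd : ∀ v, HasDerivAt φ (g v) v) (K : ℝ) {x : ℝ} (hx : 1 < |x|) :
    deriv (Fc φ K) =ᶠ[𝓝 x] fun y => g (K * (Real.sign x * y)) * (K * Real.sign x) := by
  have h := (hfun_ev hx).eventually_nhds
  filter_upwards [h] with y hy
  have e : Fc φ K =ᶠ[𝓝 y] fun y => φ (K * (Real.sign x * y)) := by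
    filter_upwards [hy] with w hw
    simp only [Fc, hw]
  rw [e.deriv_eq]
  have h2 : HasDerivAt (fun y => K * (Real.sign x * y)) (K * Real.sign x) y := by
    have := ((hasDerivAt_id y).const_mul (Real.sign x)).const_mul K
    simpa using this
  exact ((hd _).comp y h2).deriv

lemma Fc_deriv2 {φ g : ℝ → ℝ} (hd : ∀ v, HasDerivAt φ (g v) v) (hg : Antitone g) {K : ℝ}
    (hK : 0 ≤ K) {x : ℝ} (hx : 1 < |x|) : iteratedDeriv 2 (Fc φ K) x ≤ 0 := by
  rw [iter2, (Fc_deriv hd K hx).deriv_eq]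
  have hx0 : x ≠ 0 := by rintro rfl; simp at hx; linarith
  have : Antitone fun y => g (K * (Real.sign x * y)) * (K * Real.sign x) := by
    intro a b hab
    rcases lt_or_gt_of_ne hx0 with h | h
    · simp only [Real.sign_of_neg h]
      have := hg (show K * (-1 * b) ≤ K * (-1 * a) by nlinarith)
      nlinarith
    · simp only [Real.sign_of_pos h]
      have := hg (show K * (1 * a) ≤ K * (1 * b) by nlinarith)
      nlinarith
  exact this.deriv_nonpos
lemma norm1 (x : Rd 1) : ‖x‖ = |x 0| := by
  rw [EuclideanSpace.norm_eq]
  simp [Real.sqrt_sq_eq_abs]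

lemma lift_contDiff {F : ℝ → ℝ} (hF : ContDiff ℝ 2 F) : ContDiff ℝ 2 (fun y : Rd 1 => F (y 0)) :=
  hF.comp (EuclideanSpace.proj (𝕜 := ℝ) (0 : Fin 1)).contDiff

lemma lift_fderiv {F : ℝ → ℝ} (hF : ContDiff ℝ 2 F) (x z : Rd 1) :
    fderiv ℝ (fun y : Rd 1 => F (y 0)) x z = deriv F (x 0) * z 0 := by
  have h1 : HasDerivAt F (deriv F (x 0)) (EuclideanSpace.proj (𝕜 := ℝ) (0 : Fin 1) x) :=
    (hF.differentiable (by norm_num) (x 0)).hasDerivAt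
  have h2 := h1.comp_hasFDerivAt x (EuclideanSpace.proj (𝕜 := ℝ) (0 : Fin 1)).hasFDerivAt
  have h3 : fderiv ℝ (fun y : Rd 1 => F (y 0)) x = _ := h2.fderiv
  rw [h3]; simp

lemma lift_iter {F : ℝ → ℝ} (hF : ContDiff ℝ 2 F) (x : Rd 1) :
    iteratedFDeriv ℝ 2 (fun y : Rd 1 => F (y 0)) x =
      (iteratedFDeriv ℝ 2 F (x 0)).compContinuousLinearMap
        (fun _ => EuclideanSpace.proj (𝕜 := ℝ) (0 : Fin 1)) :=
  (EuclideanSpace.proj (𝕜 := ℝ) (0 : Fin 1)).iteratedFDeriv_comp_right hF x (i := 2) le_rfl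

lemma lift_iter_apply {F : ℝ → ℝ} (hF : ContDiff ℝ 2 F) (x : Rd 1) :
    iteratedFDeriv ℝ 2 (fun y : Rd 1 => F (y 0)) x
      ![EuclideanSpace.single 0 (1:ℝ), EuclideanSpace.single 0 (1:ℝ)] =
      iteratedDeriv 2 F (x 0) := by
  rw [lift_iter hF, iteratedDeriv_eq_iteratedFDeriv,
    ContinuousMultilinearMap.compContinuousLinearMap_apply]
  congr 1
  ext i
  fin_cases i <;> simp

lemma lift_bdd {F : ℝ → ℝ} (hF : ContDiff ℝ 2 F) {C : ℝ} (h0 : ∀ y, |F y| ≤ C)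
    (h1 : ∀ y, |deriv F y| ≤ C) (h2 : ∀ y, |iteratedDeriv 2 F y| ≤ C) :
    ∃ C' : ℝ, ∀ x : Rd 1, |F (x 0)| ≤ C' ∧ ‖fderiv ℝ (fun y : Rd 1 => F (y 0)) x‖ ≤ C' ∧
        ‖iteratedFDeriv ℝ 2 (fun y : Rd 1 => F (y 0)) x‖ ≤ C' := by
  have hC0 : 0 ≤ C := (abs_nonneg _).trans (h0 0)
  refine ⟨C, fun x => ⟨h0 _, ?_, ?_⟩⟩
  · refine ContinuousLinearMap.opNorm_le_bound _ hC0 fun z => ?_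
    rw [lift_fderiv hF, norm_mul, norm1 z]
    exact mul_le_mul_of_nonneg_right (h1 _) (abs_nonneg _)
  · refine ContinuousMultilinearMap.opNorm_le_bound hC0 fun v => ?_
    rw [lift_iter hF, ContinuousMultilinearMap.compContinuousLinearMap_apply]
    refine (ContinuousMultilinearMap.le_opNorm _ _).trans ?_
    rw [norm_iteratedFDeriv_eq_norm_iteratedDeriv]
    have : ∀ i, ‖(EuclideanSpace.proj (𝕜 := ℝ) (0 : Fin 1)) (v i)‖ = ‖v i‖ := fun i => by
      rw [norm1]; rfl
    simp only [this]
    exact mul_le_mul_of_nonneg_right (h2 _) (Finset.prod_nonneg fun _ _ => norm_nonneg _)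

namespace SJD
variable {m : ℕ} {Ω : Type} [MeasurableSpace Ω]

/-- jump integrand -/
def Jf (F : ℝ → ℝ) (x z : Rd 1) : ℝ :=
  F (x 0 + z 0) - F (x 0) - (if ‖z‖ < 1 then deriv F (x 0) * z 0 else 0)

lemma pit_meas_z (s : SJD 1 m Ω) (x : Rd 1) (i : Fin m) : Measurable (s.pit x i) :=
  (s.pit_meas i).comp measurable_prodMk_left

lemma G_formula (s : SJD 1 m Ω) {F : ℝ → ℝ} (hF : ContDiff ℝ 2 F) (x : Rd 1) (i : Fin m) :
    s.G (fun y _ => F (y 0)) x i = 1 / 2 * (s.a x i 0 0 * iteratedDeriv 2 F (x 0))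
      + s.b x i 0 * deriv F (x 0) + ∫ z, s.pit x i z * Jf F x z := by
  unfold G gen
  have hq : ∑ j, s.q x i j * F (x 0) = 0 := by
    rw [← Finset.sum_mul, s.q_rowsum, zero_mul]
  rw [hq, add_zero]
  simp only [Finset.univ_unique, Finset.sum_singleton, Fin.default_eq_zero, Fin.isValue]
  rw [lift_iter_apply hF, lift_fderiv hF]
  simp only [lift_fderiv hF]
  unfold π
  rw [integral_withDensity_eq_integral_toReal_smul
    ((s.pit_meas_z x i).ennreal_ofReal) (by simp)]
  congr 1
  · simp
  · refine integral_congr_ae (Filter.Eventually.of_forall fun z => ?_)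
    simp [ENNReal.toReal_ofReal (s.pit_nonneg x i z), Jf]

lemma meas_Jf {F : ℝ → ℝ} (hF : ContDiff ℝ 2 F) :
    Measurable (fun p : Rd 1 × Rd 1 => Jf F p.1 p.2) := by
  have h0 : Measurable F := hF.continuous.measurable
  have h1 : Measurable (deriv F) := measurable_deriv F
  have hc : Measurable (fun y : Rd 1 => y 0) := (EuclideanSpace.proj (𝕜 := ℝ) (0 : Fin 1)).continuous.measurable
  unfold Jf
  refine Measurable.sub ?_ (Measurable.ite ?_ ?_ measurable_const)
  · exact (h0.comp ((hc.comp measurable_fst).add (hc.comp measurable_snd))).sub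
      (h0.comp (hc.comp measurable_fst))
  · exact measurableSet_lt measurable_snd.norm measurable_const
  · exact (h1.comp (hc.comp measurable_fst)).mul (hc.comp measurable_snd)

lemma G_meas (s : SJD 1 m Ω) {F : ℝ → ℝ} (hF : ContDiff ℝ 2 F) (i : Fin m) :
    Measurable fun x => s.G (fun y _ => F (y 0)) x i := by
  simp only [s.G_formula hF]
  have hc : Measurable (fun y : Rd 1 => y 0) := (EuclideanSpace.proj (𝕜 := ℝ) (0 : Fin 1)).continuous.measurable
  have ha : Measurable fun x => s.a x i 0 0 := by
    have : Continuous fun x => s.a x i := (s.sig_cont i).matrix_mul (s.sig_cont i).matrix_transpose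
    exact (this.matrix_elem 0 0).measurable
  have hb : Measurable fun x => s.b x i 0 := hc.comp (s.b_cont i).measurable
  refine Measurable.add (Measurable.add ?_ ?_) ?_
  · exact measurable_const.mul (ha.mul ((contDiff2_cont hF).measurable.comp hc))
  · exact hb.mul ((measurable_deriv F).comp hc)
  · refine StronglyMeasurable.measurable ?_
    apply StronglyMeasurable.integral_prod_right
    exact ((s.pit_meas i).mul (meas_Jf hF)).stronglyMeasurable

lemma a_nonneg (s : SJD 1 m Ω) (x : Rd 1) (i : Fin m) : 0 ≤ s.a x i 0 0 := by
  simp only [a, Matrix.mul_apply, Matrix.transpose_apply]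
  exact Finset.sum_nonneg fun _ _ => mul_self_nonneg _

/-- small jump second moment -/
lemma small_lint (s : SJD 1 m Ω) : ∃ c > (0 : ℝ), ∀ x i,
    (∫⁻ z in Metric.ball (0 : Rd 1) 1, ENNReal.ofReal (s.pit x i z * ‖z‖ ^ 2))
      ≤ ENNReal.ofReal (c * (1 + ‖x‖ ^ 2)) := by
  obtain ⟨c, hc, h⟩ := s.smalljump
  refine ⟨c, hc, fun x i => le_trans (le_of_eq ?_) (h x i)⟩
  rw [restrict_withDensity measurableSet_ball, lintegral_withDensity_eq_lintegral_mul _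
    ((s.pit_meas_z x i).ennreal_ofReal) (by fun_prop)]
  refine lintegral_congr fun z => ?_
  simp [ENNReal.ofReal_mul (s.pit_nonneg x i z)]

lemma big_lint (s : SJD 1 m Ω) : ∃ C : ℝ≥0∞, C < ⊤ ∧ ∀ x i,
    (∫⁻ z in (Metric.ball (0 : Rd 1) 1)ᶜ, ENNReal.ofReal (s.pit x i z)) ≤ C := by
  obtain ⟨c, hc, h⟩ := s.bigjump_bdd
  refine ⟨c, hc, fun x i => le_trans (le_of_eq ?_) (h x i)⟩
  rw [withDensity_apply _ measurableSet_ball.compl]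

lemma integrable_J (s : SJD 1 m Ω)
    (hint : ∀ (x : Rd 1) (i : Fin m),
      (∫⁻ z in {z : Rd 1 | 1 ≤ ‖z‖}, ENNReal.ofReal (‖z‖ * s.pit x i z)) < ⊤)
    {F : ℝ → ℝ} (hF : ContDiff ℝ 2 F) {C : ℝ}
    (h1 : ∀ y, |deriv F y| ≤ C) (h2 : ∀ y, |iteratedDeriv 2 F y| ≤ C) (x : Rd 1) (i : Fin m) :
    Integrable fun z => s.pit x i z * Jf F x z := by
  have hm : Measurable fun z => s.pit x i z * Jf F x z :=
    (s.pit_meas_z x i).mul ((meas_Jf hF).comp measurable_prodMk_left)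
  obtain ⟨c, hc, hs⟩ := s.small_lint
  rw [← integrableOn_univ, ← union_compl_self (Metric.ball (0 : Rd 1) 1), integrableOn_union]
  have hC0 : 0 ≤ C := (abs_nonneg _).trans (h1 0)
  constructor
  · refine Integrable.mono' (g := fun z => C * (s.pit x i z * ‖z‖ ^ 2)) ?_ hm.aestronglyMeasurable ?_
    · refine Integrable.const_mul ⟨((s.pit_meas_z x i).mul (by fun_prop)).aestronglyMeasurable, ?_⟩ _
      rw [hasFiniteIntegral_iff_ofReal]
      · exact (hs x i).trans_lt ENNReal.ofReal_lt_top
      · exact Filter.Eventually.of_forall fun z => mul_nonneg (s.pit_nonneg x i z) (by positivity)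
    · rw [ae_restrict_iff' measurableSet_ball]
      refine Filter.Eventually.of_forall fun z hz => ?_
      have hz' : ‖z‖ < 1 := by simpa using hz
      have := taylor_bd hF h2 (x 0) (z 0)
      rw [norm_mul, Real.norm_eq_abs, Real.norm_eq_abs, abs_of_nonneg (s.pit_nonneg x i z), norm1, sq_abs]
      simp only [Jf, hz', if_true]
      have := mul_le_mul_of_nonneg_left this (s.pit_nonneg x i z)
      linarith
  · refine Integrable.mono' (g := fun z => C * (‖z‖ * s.pit x i z)) ?_ hm.aestronglyMeasurable ?_
    · refine Integrable.const_mul ⟨(Measurable.mul (by fun_prop) (s.pit_meas_z x i)).aestronglyMeasurable, ?_⟩ _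
      rw [hasFiniteIntegral_iff_ofReal]
      · have e : (Metric.ball (0 : Rd 1) 1)ᶜ = {z | 1 ≤ ‖z‖} := by ext z; simp
        rw [e]; exact hint x i
      · exact Filter.Eventually.of_forall fun z => mul_nonneg (norm_nonneg _) (s.pit_nonneg x i z)
    · rw [ae_restrict_iff' measurableSet_ball.compl]
      refine Filter.Eventually.of_forall fun z hz => ?_
      have hz' : ¬ ‖z‖ < 1 := by simpa using hz
      have := lip_bd hF h1 (x 0) (z 0)
      rw [norm_mul, Real.norm_eq_abs, Real.norm_eq_abs, abs_of_nonneg (s.pit_nonneg x i z), norm1]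
      simp only [Jf, hz', if_false, sub_zero]
      have := mul_le_mul_of_nonneg_left this (s.pit_nonneg x i z)
      linarith

/-- the generator is bounded on functions constant outside a compact set -/
lemma G_bdd (s : SJD 1 m Ω)
    {F : ℝ → ℝ} (hF : ContDiff ℝ 2 F) {C L : ℝ} (h0 : ∀ y, |F y| ≤ C)
    (h1 : ∀ y, |deriv F y| ≤ C) (h2 : ∀ y, |iteratedDeriv 2 F y| ≤ C)
    (hL : 0 ≤ L) (c1 c2 : ℝ) (hc1 : ∀ y, L < y → F y = c1) (hc2 : ∀ y, y < -L → F y = c2) :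
    ∃ B : ℝ, ∀ x i, |s.G (fun y _ => F (y 0)) x i| ≤ B := by
  have hC0 : 0 ≤ C := (abs_nonneg _).trans (h1 0)
  obtain ⟨c, hc, hs⟩ := s.small_lint
  obtain ⟨Cb, hCb, hb⟩ := s.big_lint
  obtain ⟨cg, hcg, hgr⟩ := s.growth
  -- derivatives vanish far away
  have hev : ∀ y, L < |y| → ∃ k, F =ᶠ[𝓝 y] fun _ => k := by
    intro y hy
    rcases lt_abs.1 hy with h | h
    · exact ⟨c1, by filter_upwards [lt_mem_nhds h] with w hw using hc1 w hw⟩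
    · exact ⟨c2, by filter_upwards [gt_mem_nhds (show y < -L by linarith)] with w hw using hc2 w hw⟩
  have hd1 : ∀ y, L < |y| → deriv F y = 0 := by
    intro y hy; obtain ⟨k, hk⟩ := hev y hy
    rw [hk.deriv_eq]; simp
  have hd2 : ∀ y, L < |y| → iteratedDeriv 2 F y = 0 := by
    intro y hy; obtain ⟨k, hk⟩ := hev y hy
    rw [iter2, hk.deriv.deriv_eq]; simp
  have hsmall : ∀ (x z : Rd 1), ‖z‖ < 1 → L + 1 < ‖x‖ → Jf F x z = 0 := by
    intro x z hz hx
    rw [norm1] at hz hx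
    simp only [Jf, hd1 (x 0) (by linarith), zero_mul, ite_self, sub_zero]
    rw [abs_lt] at hz
    rcases lt_abs.1 hx with h | h
    · rw [hc1 _ (by linarith), hc1 _ (by linarith), sub_self]
    · rw [hc2 _ (by linarith), hc2 _ (by linarith), sub_self]
  have hJ : ∀ x i, |∫ z, s.pit x i z * Jf F x z| ≤
      C * (c * (1 + (L + 1) ^ 2)) + 2 * C * Cb.toReal := by
    intro x i
    have hbd : 0 ≤ C * (c * (1 + (L + 1) ^ 2)) := by positivity
    have key : ‖∫ z, s.pit x i z * Jf F x z‖ₑ ≤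
        ENNReal.ofReal (C * (c * (1 + (L + 1) ^ 2)) + 2 * C * Cb.toReal) := by
      refine (enorm_integral_le_lintegral_enorm _).trans ?_
      rw [← lintegral_add_compl _ (measurableSet_ball (x := (0 : Rd 1)) (ε := 1)),
        ENNReal.ofReal_add hbd (by positivity)]
      refine add_le_add ?_ ?_
      · rcases le_or_gt ‖x‖ (L + 1) with hx | hx
        · calc ∫⁻ z in ball (0 : Rd 1) 1, ‖s.pit x i z * Jf F x z‖ₑ
              ≤ ∫⁻ z in ball (0 : Rd 1) 1, ENNReal.ofReal C * ENNReal.ofReal (s.pit x i z * ‖z‖ ^ 2) := by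
                refine setLIntegral_mono' measurableSet_ball fun z hz => ?_
                have hz' : ‖z‖ < 1 := by simpa using hz
                have := taylor_bd hF h2 (x 0) (z 0)
                rw [← ENNReal.ofReal_mul hC0, ← ofReal_norm]
                apply ENNReal.ofReal_le_ofReal
                rw [norm_mul, Real.norm_eq_abs, Real.norm_eq_abs,
                  abs_of_nonneg (s.pit_nonneg x i z), norm1, sq_abs]
                simp only [Jf, hz', if_true]
                have := mul_le_mul_of_nonneg_left this (s.pit_nonneg x i z)
                linarith
            _ = ENNReal.ofReal C * ∫⁻ z in ball (0 : Rd 1) 1, ENNReal.ofReal (s.pit x i z * ‖z‖ ^ 2) :=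
                lintegral_const_mul' _ _ ENNReal.ofReal_ne_top
            _ ≤ ENNReal.ofReal C * ENNReal.ofReal (c * (1 + ‖x‖ ^ 2)) := by gcongr; exact hs x i
            _ ≤ _ := by
                rw [← ENNReal.ofReal_mul hC0]
                apply ENNReal.ofReal_le_ofReal
                gcongr
        · rw [setLIntegral_congr_fun (g := fun _ => 0) measurableSet_ball (fun z hz => by
            simp [hsmall x z (by simpa using hz) hx])]
          simp
      · calc ∫⁻ z in (ball (0 : Rd 1) 1)ᶜ, ‖s.pit x i z * Jf F x z‖ₑ
              ≤ ∫⁻ z in (ball (0 : Rd 1) 1)ᶜ, ENNReal.ofReal (2 * C) * ENNReal.ofReal (s.pit x i z) := by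
                refine setLIntegral_mono' measurableSet_ball.compl fun z hz => ?_
                have hz' : ¬ ‖z‖ < 1 := by simpa using hz
                rw [← ENNReal.ofReal_mul (by positivity), ← ofReal_norm]
                apply ENNReal.ofReal_le_ofReal
                rw [norm_mul, Real.norm_eq_abs, Real.norm_eq_abs,
                  abs_of_nonneg (s.pit_nonneg x i z)]
                simp only [Jf, hz', if_false, sub_zero]
                have : |F (x 0 + z 0) - F (x 0)| ≤ 2 * C := by
                  have := abs_sub (F (x 0 + z 0)) (F (x 0))
                  have := h0 (x 0 + z 0)
                  have := h0 (x 0)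
                  linarith
                have := mul_le_mul_of_nonneg_left this (s.pit_nonneg x i z)
                linarith
            _ = ENNReal.ofReal (2 * C) * ∫⁻ z in (ball (0 : Rd 1) 1)ᶜ, ENNReal.ofReal (s.pit x i z) :=
                lintegral_const_mul' _ _ ENNReal.ofReal_ne_top
            _ ≤ ENNReal.ofReal (2 * C) * Cb := by gcongr; exact hb x i
            _ = _ := by
                rw [ENNReal.ofReal_mul (by positivity : 0 ≤ 2 * C), ENNReal.ofReal_toReal hCb.ne]
    rw [← ofReal_norm] at key
    exact (ENNReal.ofReal_le_ofReal_iff (by positivity)).1 key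
  refine ⟨1 / 2 * ((cg * (1 + L)) ^ 2 * C) + cg * (1 + L) * C +
    (C * (c * (1 + (L + 1) ^ 2)) + 2 * C * Cb.toReal), fun x i => ?_⟩
  rw [s.G_formula hF]
  refine (abs_add_le _ _).trans (add_le_add ((abs_add_le _ _).trans (add_le_add ?_ ?_)) (hJ x i))
  · rcases lt_or_ge L |x 0| with hx | hx
    · rw [hd2 _ hx]; simp; positivity
    · have hg := hgr x i
      simp only [Finset.univ_unique, Finset.sum_singleton, Fin.default_eq_zero] at hg
      have ha : s.a x i 0 0 = s.sig x i 0 0 ^ 2 := by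
        simp [a, Matrix.mul_apply]; ring
      rw [norm1] at hg
      have h3 : |s.sig x i 0 0| ≤ cg * (1 + L) := by
        have := abs_nonneg (s.b x i 0)
        nlinarith
      rw [abs_mul, abs_mul, ha, abs_pow]
      have : |(1:ℝ) / 2| = 1 / 2 := by norm_num
      rw [this]
      gcongr
      exact h2 _
  · rcases lt_or_ge L |x 0| with hx | hx
    · rw [hd1 _ hx]; simp; positivity
    · have hg := hgr x i
      simp only [Finset.univ_unique, Finset.sum_singleton, Fin.default_eq_zero] at hg
      rw [norm1] at hg
      have h3 : |s.b x i 0| ≤ cg * (1 + L) := by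
        have := abs_nonneg (s.sig x i 0 0)
        nlinarith
      rw [abs_mul]
      gcongr
      exact h1 _

end SJD
namespace SJD
variable {m : ℕ} {Ω : Type} [MeasurableSpace Ω]

lemma abs_aux {x z : ℝ} (hx : 2 ≤ |x|) (hz : |z| ≤ |x|) :
    |x + z| = |x| + Real.sign x * z := by
  have hx0 : x ≠ 0 := by rintro rfl; simp at hx; linarith
  rw [abs_le] at hz
  rcases lt_or_gt_of_ne hx0 with h | h
  · rw [abs_of_neg h] at hz ⊢
    rw [Real.sign_of_neg h, abs_of_nonpos (by linarith)]; ring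
  · rw [abs_of_pos h] at hz ⊢
    rw [Real.sign_of_pos h, abs_of_nonneg (by linarith)]; ring

lemma drift (s : SJD 1 m Ω)
    (hint : ∀ (x : Rd 1) (i : Fin m),
      (∫⁻ z in {z : Rd 1 | 1 ≤ ‖z‖}, ENNReal.ofReal (‖z‖ * s.pit x i z)) < ⊤)
    {K ε R : ℝ} (hK : 0 < K) (hKε : 1 ≤ K * ε) (hR : 2 ≤ R)
    (hl : ∀ x : Rd 1, R ≤ ‖x‖ → ∀ i,
      (s.b x i 0 + ∫ z in {z : Rd 1 | 1 < ‖z‖ ∧ ‖z‖ ≤ ‖x‖}, z 0 * s.pit x i z) *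
          Real.sign (x 0) +
        (∫ z in {z : Rd 1 | ‖x‖ < ‖z‖}, ‖z‖ * s.pit x i z) ≤ -ε)
    {φ g : ℝ → ℝ} (hφ : ContDiff ℝ 2 φ) (hd : ∀ v, HasDerivAt φ (g v) v) (hg : Antitone g)
    (hg0 : ∀ v, 0 ≤ g v) {C : ℝ}
    (h1 : ∀ y, |deriv (Fc φ K) y| ≤ C) (h2 : ∀ y, |iteratedDeriv 2 (Fc φ K) y| ≤ C)
    (x : Rd 1) (hx : R ≤ ‖x‖) (i : Fin m) :
    s.G (fun y _ => Fc φ K (y 0)) x i ≤ - g (K * hfun (x 0)) := by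
  have hF := Fc_contDiff hφ K
  rw [s.G_formula hF]
  have hx2 : 2 ≤ |x 0| := by rw [← norm1]; linarith
  have hh : hfun (x 0) = |x 0| := hfun_eq_abs (by linarith)
  set γ := g (K * hfun (x 0)) with hγ
  set σ := Real.sign (x 0) with hσ
  have hγ0 : 0 ≤ γ := hg0 _
  have hder : deriv (Fc φ K) (x 0) = γ * (K * σ) := by
    rw [(Fc_deriv hd K (x := x 0) (by linarith)).eq_of_nhds, hγ, hh, ← sign_mul_abs', mul_comm (x 0)]
  have hd2 := Fc_deriv2 hd hg hK.le (x := x 0) (by linarith)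
  set S1 := {z : Rd 1 | 1 < ‖z‖ ∧ ‖z‖ ≤ ‖x‖} with hS1
  set S2 := {z : Rd 1 | ‖x‖ < ‖z‖} with hS2
  have mS1 : MeasurableSet S1 :=
    (measurableSet_lt measurable_const measurable_norm).inter
      (measurableSet_le measurable_norm measurable_const)
  have mS2 : MeasurableSet S2 := measurableSet_lt measurable_const measurable_norm
  have hI : IntegrableOn (fun z => ‖z‖ * s.pit x i z) {z : Rd 1 | 1 ≤ ‖z‖} := by
    refine ⟨(measurable_norm.mul (s.pit_meas_z x i)).aestronglyMeasurable, ?_⟩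
    rw [hasFiniteIntegral_iff_ofReal]
    · exact hint x i
    · exact Filter.Eventually.of_forall fun z => mul_nonneg (norm_nonneg _) (s.pit_nonneg x i z)
  have hI2 : IntegrableOn (fun z => ‖z‖ * s.pit x i z) S2 := by
    refine hI.mono_set fun z (hz : ‖x‖ < ‖z‖) => ?_
    show 1 ≤ ‖z‖
    linarith
  have hc : Measurable (fun y : Rd 1 => y 0) := (EuclideanSpace.proj (𝕜 := ℝ) (0 : Fin 1)).continuous.measurable
  have hI1 : IntegrableOn (fun z => z 0 * s.pit x i z) S1 := by
    refine Integrable.mono' (hI.mono_set (fun z hz => hz.1.le))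
      (hc.mul (s.pit_meas_z x i)).aestronglyMeasurable
      (Filter.Eventually.of_forall fun z => ?_)
    rw [norm_mul, Real.norm_eq_abs, Real.norm_eq_abs, abs_of_nonneg (s.pit_nonneg x i z), norm1]
  have hJ : ∫ z, s.pit x i z * Jf (Fc φ K) x z ≤
      ∫ z, γ * K * (σ * S1.indicator (fun z => z 0 * s.pit x i z) z +
        S2.indicator (fun z => ‖z‖ * s.pit x i z) z) := by
    refine integral_mono_ae (s.integrable_J hint hF h1 h2 x i)
      (((((integrable_indicator_iff mS1).2 hI1).const_mul _).add
        ((integrable_indicator_iff mS2).2 hI2)).const_mul _) ?_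
    have hne : ∀ᵐ z : Rd 1, z ∉ sphere (0 : Rd 1) 1 :=
      measure_eq_zero_iff_ae_notMem.1 (Measure.addHaar_sphere volume (0 : Rd 1) 1)
    filter_upwards [hne] with z hz
    have hz1 : ‖z‖ ≠ 1 := by simpa using hz
    have htan := tangent_le hd hg (K * hfun (x 0)) (K * hfun (x 0 + z 0))
    rw [← hγ] at htan
    have hle := hfun_le_abs (x 0 + z 0)
    have hp := s.pit_nonneg x i z
    have hgK : 0 ≤ γ * K := mul_nonneg hγ0 hK.le
    have htan2 : φ (K * hfun (x 0 + z 0)) - φ (K * hfun (x 0)) ≤ γ * K * (|x 0 + z 0| - |x 0|) := by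
      have := mul_le_mul_of_nonneg_left hle hgK
      rw [hh] at htan ⊢
      linarith
    rcases lt_or_gt_of_ne hz1 with h | h
    · have n1 : z ∉ S1 := fun h' => absurd h'.1 (by linarith)
      have n2 : z ∉ S2 := fun h' => absurd (show ‖x‖ < ‖z‖ from h') (by linarith)
      rw [indicator_of_notMem n1, indicator_of_notMem n2]
      simp only [Jf, h, if_true, hder, Fc]
      rw [abs_aux hx2 (by rw [← norm1, ← norm1]; linarith), ← hσ] at htan2
      have : φ (K * hfun (x 0 + z 0)) - φ (K * hfun (x 0)) - γ * (K * σ) * z 0 ≤ 0 := by linarith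
      have := mul_le_mul_of_nonneg_left this hp
      linarith
    · have h' : ¬ ‖z‖ < 1 := by linarith
      simp only [Jf, h', if_false, sub_zero, Fc]
      have h3 := mul_le_mul_of_nonneg_left htan2 hp
      rcases le_or_gt ‖z‖ ‖x‖ with h4 | h4
      · have n1 : z ∈ S1 := ⟨h, h4⟩
        have n2 : z ∉ S2 := fun h' => absurd (show ‖x‖ < ‖z‖ from h') (by linarith)
        rw [indicator_of_mem n1, indicator_of_notMem n2]
        rw [abs_aux hx2 (by rw [← norm1, ← norm1]; linarith), ← hσ] at h3
        linarith
      · have n1 : z ∉ S1 := fun h' => absurd h'.2 (by linarith)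
        have n2 : z ∈ S2 := h4
        rw [indicator_of_notMem n1, indicator_of_mem n2, norm1 z]
        have h5 : |x 0 + z 0| - |x 0| ≤ |z 0| := by have := abs_add_le (x 0) (z 0); linarith
        have h6 := mul_le_mul_of_nonneg_left (mul_le_mul_of_nonneg_left h5 hgK) hp
        linarith
  have hE : ∫ z, γ * K * (σ * S1.indicator (fun z => z 0 * s.pit x i z) z +
        S2.indicator (fun z => ‖z‖ * s.pit x i z) z) =
      γ * K * (σ * (∫ z in S1, z 0 * s.pit x i z) + ∫ z in S2, ‖z‖ * s.pit x i z) := by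
    rw [integral_const_mul, integral_add (((integrable_indicator_iff mS1).2 hI1).const_mul _)
        ((integrable_indicator_iff mS2).2 hI2), integral_const_mul, integral_indicator mS1,
        integral_indicator mS2]
  have hl' := hl x hx i
  have ha := mul_nonpos_of_nonneg_of_nonpos (s.a_nonneg x i) hd2
  rw [hE] at hJ
  rw [hder]
  have hgK : 0 ≤ γ * K := mul_nonneg hγ0 hK.le
  have h7 := mul_le_mul_of_nonneg_left hl' hgK
  have h8 : γ * 1 ≤ γ * (K * ε) := mul_le_mul_of_nonneg_left hKε hγ0
  linarith

lemma Fc_id_bdd (K : ℝ) : ∃ C, (∀ y, |deriv (Fc id K) y| ≤ C) ∧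
    (∀ y, |iteratedDeriv 2 (Fc id K) y| ≤ C) := by
  have hF := Fc_contDiff (φ := id) contDiff_id K
  have hd : ∀ v, HasDerivAt (id : ℝ → ℝ) ((fun _ => 1) v) v := fun v => hasDerivAt_id v
  obtain ⟨C1, h1⟩ := bdd_of_cont (contDiff2_deriv hF).continuous (L := 1) (c := |K|) (by
    intro y hy
    rw [(Fc_deriv hd K hy).eq_of_nhds]
    simp only [one_mul, abs_mul]
    refine mul_le_of_le_one_right (abs_nonneg _) ?_
    rcases Real.sign_apply_eq y with h | h | h <;> rw [h] <;> norm_num)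
  obtain ⟨C2, h2⟩ := bdd_of_cont (contDiff2_cont hF) (L := 1) (c := 0) (by
    intro y hy
    rw [iter2, (Fc_deriv hd K hy).deriv_eq]
    simp)
  exact ⟨max C1 C2, fun y => (h1 y).trans (le_max_left _ _), fun y => (h2 y).trans (le_max_right _ _)⟩

lemma Fc_tr_const {K N : ℝ} {y : ℝ} (h1 : 1 ≤ |y|) (hy : N + 1 ≤ K * |y|) :
    Fc (phitr N) K y = phitr N (N + 1) := by
  unfold Fc
  rw [hfun_eq_abs h1, phitr_const N hy]

lemma Fc_tr_bdd {K N : ℝ} (hK : 0 < K) : ∃ C L : ℝ, 0 ≤ L ∧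
    (∀ y, |Fc (phitr N) K y| ≤ C) ∧ (∀ y, |deriv (Fc (phitr N) K) y| ≤ C) ∧
    (∀ y, |iteratedDeriv 2 (Fc (phitr N) K) y| ≤ C) ∧
    (∀ y, L < |y| → Fc (phitr N) K y = phitr N (N + 1)) := by
  have hF := Fc_contDiff (phitr_contDiff N) K
  set L := max 1 ((N + 1) / K) with hL
  have hc : ∀ y, L < |y| → Fc (phitr N) K y = phitr N (N + 1) := by
    intro y hy
    have h1 := (le_max_left 1 ((N + 1) / K)).trans_lt hy
    have h2 := (le_max_right 1 ((N + 1) / K)).trans_lt hy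
    rw [div_lt_iff₀ hK] at h2
    exact Fc_tr_const h1.le (by linarith)
  have hev : ∀ y, L < |y| → Fc (phitr N) K =ᶠ[𝓝 y] fun _ => phitr N (N + 1) := by
    intro y hy
    filter_upwards [continuous_abs.continuousAt.eventually (lt_mem_nhds hy)] with w hw using hc w hw
  obtain ⟨C0, h0⟩ := bdd_of_cont hF.continuous (L := L) (c := |phitr N (N + 1)|) (by
    intro y hy; rw [hc y hy])
  obtain ⟨C1, h1⟩ := bdd_of_cont (contDiff2_deriv hF).continuous (L := L) (c := 0) (by
    intro y hy
    rw [(hev y hy).deriv_eq]; simp)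
  obtain ⟨C2, h2⟩ := bdd_of_cont (contDiff2_cont hF) (L := L) (c := 0) (by
    intro y hy
    rw [iter2, (hev y hy).deriv.deriv_eq]; simp)
  exact ⟨max C0 (max C1 C2), L, zero_le_one.trans (le_max_left _ _),
    fun y => (h0 y).trans (le_max_left _ _),
    fun y => (h1 y).trans ((le_max_left _ _).trans (le_max_right _ _)),
    fun y => (h2 y).trans ((le_max_right _ _).trans (le_max_right _ _)), hc⟩

end SJD
namespace SJD
variable {m : ℕ} {Ω : Type} [MeasurableSpace Ω]

/-- grid points -/
def tg (n j : ℕ) : ℝ≥0 := (j : ℝ≥0) / ((n : ℝ≥0) + 1)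

lemma tg_coe (n j : ℕ) : ((tg n j : ℝ≥0) : ℝ) = (j : ℝ) / ((n : ℝ) + 1) := by
  simp [tg]

lemma Z_meas_t (s : SJD 1 m Ω) (t : ℝ≥0) : Measurable fun ω => (s.X t ω, s.Λ t ω) :=
  (s.adapted t).mono (s.ℱ.le t) le_rfl

lemma tg_tendsto (u : ℝ≥0) :
    Tendsto (fun n : ℕ => tg n (⌊(u : ℝ) * ((n : ℝ) + 1)⌋₊ + 1)) atTop (𝓝[≥] u) := by
  refine tendsto_nhdsWithin_iff.2 ⟨?_, Filter.Eventually.of_forall fun n => ?_⟩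
  · rw [← NNReal.tendsto_coe]
    have h0 : Tendsto (fun n : ℕ => (u : ℝ) + 1 / ((n : ℝ) + 1)) atTop (𝓝 ((u : ℝ) + 0)) :=
      tendsto_const_nhds.add tendsto_one_div_add_atTop_nhds_zero_nat
    rw [add_zero] at h0
    refine tendsto_of_tendsto_of_tendsto_of_le_of_le tendsto_const_nhds h0 (fun n => ?_) (fun n => ?_)
    · have hn : (0 : ℝ) < (n : ℝ) + 1 := by positivity
      simp only [tg_coe]
      rw [le_div_iff₀ hn]
      push_cast
      exact (Nat.lt_floor_add_one _).le
    · have hn : (0 : ℝ) < (n : ℝ) + 1 := by positivity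
      simp only [tg_coe]
      rw [div_le_iff₀ hn, add_mul, one_div, inv_mul_cancel₀ hn.ne']
      push_cast
      have := Nat.floor_le (a := (u : ℝ) * ((n : ℝ) + 1)) (by positivity)
      linarith
  · have hn : (0 : ℝ) < (n : ℝ) + 1 := by positivity
    show u ≤ _
    rw [← NNReal.coe_le_coe, tg_coe, le_div_iff₀ hn]
    push_cast
    exact (Nat.lt_floor_add_one _).le

lemma comp_grid {E : Type*} [MeasurableSpace E] (f : ℝ≥0 → Ω → E)
    (hf : ∀ t, Measurable (f t)) (n : ℕ) :
    Measurable fun p : Ω × ℝ =>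
      f (tg n (⌊(p.2.toNNReal : ℝ) * ((n : ℝ) + 1)⌋₊ + 1)) p.1 := by
  have h1 : Measurable fun q : Ω × ℕ => f (tg n (q.2 + 1)) q.1 :=
    measurable_from_prod_countable_left fun k => hf (tg n (k + 1))
  have h2 : Measurable fun p : Ω × ℝ => (p.1, ⌊(p.2.toNNReal : ℝ) * ((n : ℝ) + 1)⌋₊) := by
    refine measurable_fst.prodMk (Nat.measurable_floor.comp ?_)
    exact (measurable_snd.real_toNNReal.coe_nnreal_real).mul measurable_const
  exact Measurable.comp (g := fun q : Ω × ℕ => f (tg n (q.2 + 1)) q.1)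
    (f := fun p : Ω × ℝ => (p.1, ⌊(p.2.toNNReal : ℝ) * ((n : ℝ) + 1)⌋₊)) h1 h2

lemma Z_meas (s : SJD 1 m Ω) :
    Measurable fun p : Ω × ℝ => (s.X p.2.toNNReal p.1, s.Λ p.2.toNNReal p.1) := by
  refine measurable_of_tendsto_metrizable (f := fun (n : ℕ) (p : Ω × ℝ) =>
    (s.X (tg n (⌊(p.2.toNNReal : ℝ) * ((n : ℝ) + 1)⌋₊ + 1)) p.1,
     s.Λ (tg n (⌊(p.2.toNNReal : ℝ) * ((n : ℝ) + 1)⌋₊ + 1)) p.1)) (fun n => ?_) ?_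
  · exact comp_grid (fun t ω => (s.X t ω, s.Λ t ω)) s.Z_meas_t n
  · rw [tendsto_pi_nhds]
    intro p
    exact (s.cadlag_right p.1 p.2.toNNReal).tendsto.comp (tg_tendsto _)

lemma comp_pair {A E : Type*} [MeasurableSpace A] [MeasurableSpace E] (g : E → Fin m → ℝ)
    (hg : ∀ i, Measurable fun x => g x i) (X : A → E) (L : A → Fin m)
    (h : Measurable fun p => (X p, L p)) : Measurable fun p => g (X p) (L p) := by
  have h' : Measurable (fun q : E × Fin m => g q.1 q.2) :=
    measurable_from_prod_countable_left fun i => hg i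
  exact Measurable.comp (g := fun q : E × Fin m => g q.1 q.2) (f := fun p => (X p, L p)) h' h

lemma H_meas (s : SJD 1 m Ω) {F : ℝ → ℝ} (hF : ContDiff ℝ 2 F) :
    Measurable fun p : Ω × ℝ =>
      s.G (fun y _ => F (y 0)) (s.X p.2.toNNReal p.1) (s.Λ p.2.toNNReal p.1) :=
  comp_pair (s.G (fun y _ => F (y 0))) (fun i => s.G_meas hF i)
    (fun p : Ω × ℝ => s.X p.2.toNNReal p.1) (fun p => s.Λ p.2.toNNReal p.1) s.Z_meas

/-- not in the ball at grid times before `u` -/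
def Wn (s : SJD 1 m Ω) (R : ℝ) (n : ℕ) : Set (Ω × ℝ) :=
  {p | ∀ j : ℕ, ((tg n j : ℝ≥0) : ℝ) < p.2 → R ≤ ‖s.X (tg n j) p.1‖}

/-- not in the ball before `u` -/
def Ws (s : SJD 1 m Ω) (R : ℝ) : Set (Ω × ℝ) := ⋂ n, s.Wn R n

/-- not in the ball at the first `k` grid times -/
def Bk (s : SJD 1 m Ω) (R : ℝ) (n k : ℕ) : Set Ω := {ω | ∀ j < k, R ≤ ‖s.X (tg n j) ω‖}

lemma Wn_meas (s : SJD 1 m Ω) (R : ℝ) (n : ℕ) : MeasurableSet (s.Wn R n) := by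
  have : s.Wn R n = ⋂ j : ℕ, ({p : Ω × ℝ | ((tg n j : ℝ≥0) : ℝ) < p.2}ᶜ ∪
      {p | R ≤ ‖s.X (tg n j) p.1‖}) := by
    ext p; simp only [Wn, mem_ofPred_eq, mem_iInter, mem_union, mem_compl_iff, imp_iff_not_or]
  rw [this]
  refine MeasurableSet.iInter fun j => (measurableSet_lt measurable_const measurable_snd).compl.union ?_
  exact measurableSet_le measurable_const
    (((s.Z_meas_t _).fst.comp measurable_fst).norm)

lemma Ws_meas (s : SJD 1 m Ω) (R : ℝ) : MeasurableSet (s.Ws R) :=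
  MeasurableSet.iInter fun n => s.Wn_meas R n

lemma Bk_meas (s : SJD 1 m Ω) (R : ℝ) (n k : ℕ) :
    MeasurableSet[s.ℱ (tg n k)] (s.Bk R n (k + 1)) := by
  have : s.Bk R n (k + 1) = ⋂ j : ℕ, ⋂ (_ : j < k + 1), {ω | R ≤ ‖s.X (tg n j) ω‖} := by
    ext ω; simp [Bk]
  rw [this]
  refine MeasurableSet.iInter fun j => MeasurableSet.iInter fun hj => ?_
  have hle : tg n j ≤ tg n k := by
    unfold tg
    have : (j : ℝ≥0) ≤ k := by exact_mod_cast Nat.lt_succ_iff.1 hj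
    gcongr
  have h1 : MeasurableSet[s.ℱ (tg n j)] {ω | R ≤ ‖s.X (tg n j) ω‖} :=
    (s.adapted (tg n j)) (measurableSet_le measurable_const measurable_fst.norm)
  exact s.ℱ.mono hle _ h1

lemma hit_ev (s : SJD 1 m Ω) {R : ℝ} {ω : Ω} {t : ℝ≥0} {u : ℝ} (htu : (t : ℝ) < u)
    (ht : ‖s.X t ω‖ < R) : ∀ᶠ n in atTop, (ω, u) ∉ s.Wn R n := by
  have h1 : Tendsto (fun r => ‖s.X r ω‖) (𝓝[≥] t) (𝓝 ‖s.X t ω‖) :=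
    ((continuous_fst.tendsto _).comp (s.cadlag_right ω t).tendsto).norm
  have h2 := (h1.comp (tg_tendsto t)).eventually (gt_mem_nhds ht)
  have h3 : Tendsto (fun n : ℕ => ((tg n (⌊(t : ℝ) * ((n : ℝ) + 1)⌋₊ + 1) : ℝ≥0) : ℝ)) atTop (𝓝 t) :=
    NNReal.tendsto_coe.2 ((tg_tendsto t).mono_right nhdsWithin_le_nhds)
  filter_upwards [h2, h3.eventually (gt_mem_nhds htu)] with n hn hn' hW
  exact absurd (hW _ hn') (not_le.2 hn)

lemma Ws_spec (s : SJD 1 m Ω) {R : ℝ} {ω : Ω} {u : ℝ} (h : (ω, u) ∈ s.Ws R) {t : ℝ≥0}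
    (htu : (t : ℝ) < u) : R ≤ ‖s.X t ω‖ := by
  by_contra hc
  obtain ⟨n, hn⟩ := (s.hit_ev htu (not_le.1 hc)).exists
  exact hn (mem_iInter.1 h n)

lemma occ_step (s : SJD 1 m Ω) {F : ℝ → ℝ} (hF : ContDiff ℝ 2 F) {C B R : ℝ}
    (h0 : ∀ y, |F y| ≤ C) (h1 : ∀ y, |deriv F y| ≤ C) (h2 : ∀ y, |iteratedDeriv 2 F y| ≤ C)
    (hpos : ∀ y, 0 ≤ F y) (hB : ∀ x i, |s.G (fun y _ => F (y 0)) x i| ≤ B)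
    (x : Rd 1) (i : Fin m) (n k : ℕ) :
    ∫ ω in s.Bk R n k, F (s.X (tg n k) ω 0) ∂(s.P x i) ≤ F (x 0) +
      ∫ p in (univ ×ˢ Ioc (0:ℝ) (tg n k)) ∩ s.Wn R n,
        s.G (fun y _ => F (y 0)) (s.X p.2.toNNReal p.1) (s.Λ p.2.toNNReal p.1)
          ∂((s.P x i).prod volume) := by
  have := s.prob x i
  set P := s.P x i
  set H : Ω × ℝ → ℝ := fun p =>
    s.G (fun y _ => F (y 0)) (s.X p.2.toNNReal p.1) (s.Λ p.2.toNNReal p.1) with hH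
  have hHm : Measurable H := s.H_meas hF
  have hHi : ∀ a b : ℝ, Integrable H (P.prod (volume.restrict (Ioc a b))) := fun a b =>
    Integrable.of_bound hHm.aestronglyMeasurable B (Filter.Eventually.of_forall fun p => hB _ _)
  have hHi' : ∀ (A : Set Ω) (a b : ℝ), IntegrableOn H (A ×ˢ Ioc a b) (P.prod volume) := by
    intro A a b
    refine IntegrableOn.mono_set ?_ (prod_mono_left (subset_univ A))
    unfold IntegrableOn
    rw [← Measure.prod_restrict, Measure.restrict_univ]
    exact hHi a b
  have hc : Measurable (fun y : Rd 1 => y 0) := (EuclideanSpace.proj (𝕜 := ℝ) (0 : Fin 1)).continuous.measurable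
  have hFi : ∀ t, Integrable (fun ω => F (s.X t ω 0)) P := fun t =>
    Integrable.of_bound (hF.continuous.measurable.comp (hc.comp (s.Z_meas_t t).fst)).aestronglyMeasurable C
      (Filter.Eventually.of_forall fun p => h0 _)
  have hM : Martingale (fun t ω => F (s.X t ω 0) - F (x 0) -
      ∫ u in Ioc (0:ℝ) (t:ℝ), H (ω, u)) s.ℱ P :=
    s.martingale_problem (fun y _ => F (y 0)) (fun _ => lift_contDiff hF)
      (fun _ => lift_bdd hF h0 h1 h2) x i
  induction k with
  | zero =>
    have e1 : tg n 0 = 0 := by simp [tg]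
    have e2 : s.Bk R n 0 = univ := by ext; simp [Bk]
    rw [e1, e2]
    simp only [NNReal.coe_zero, Ioc_self, prod_empty, empty_inter, Measure.restrict_empty,
      integral_zero_measure, add_zero, Measure.restrict_univ]
    have hae : ∀ᵐ ω ∂P, F (s.X 0 ω 0) = F (x 0) := by
      have hm : MeasurableSet {ω | s.X 0 ω = x ∧ s.Λ 0 ω = i} := by
        have := s.Z_meas_t 0 (measurableSet_singleton (x, i))
        convert this using 1
        ext ω; simp
      have := (prob_compl_eq_zero_iff hm).2 (s.init x i)
      have h3 : ∀ᵐ ω ∂P, ω ∈ {ω | s.X 0 ω = x ∧ s.Λ 0 ω = i} := this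
      filter_upwards [h3] with ω hω
      rw [hω.1]
    rw [integral_congr_ae hae]; simp
  | succ k ih =>
    have hle : tg n k ≤ tg n (k + 1) := by
      unfold tg
      gcongr
      simp
    have hle' : ((tg n k : ℝ≥0) : ℝ) ≤ tg n (k + 1) := hle
    have hBm' := s.Bk_meas R n k
    have hBm : MeasurableSet (s.Bk R n (k + 1)) := s.ℱ.le _ _ hBm'
    -- set decomposition
    have hset : (univ ×ˢ Ioc (0:ℝ) (tg n (k + 1))) ∩ s.Wn R n =
        ((univ ×ˢ Ioc (0:ℝ) (tg n k)) ∩ s.Wn R n) ∪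
          (s.Bk R n (k + 1)) ×ˢ Ioc ((tg n k : ℝ≥0) : ℝ) (tg n (k + 1)) := by
      have hlt : ∀ j l : ℕ, ((tg n j : ℝ≥0) : ℝ) ≤ tg n l ↔ j ≤ l := by
        intro j l
        rw [tg_coe, tg_coe, div_le_div_iff_of_pos_right (by positivity)]
        exact Nat.cast_le
      ext ⟨ω, u⟩
      simp only [mem_inter_iff, mem_prod, mem_univ, true_and, mem_Ioc, mem_union]
      constructor
      · rintro ⟨⟨hu0, hu1⟩, hW⟩
        rcases le_or_gt u (tg n k) with h | h
        · exact Or.inl ⟨⟨hu0, h⟩, hW⟩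
        · refine Or.inr ⟨fun j hj => hW j ?_, h, hu1⟩
          exact ((hlt j k).2 (Nat.lt_succ_iff.1 hj)).trans_lt h
      · rintro (⟨⟨hu0, hu1⟩, hW⟩ | ⟨hω, h, hu1⟩)
        · exact ⟨⟨hu0, hu1.trans hle'⟩, hW⟩
        · refine ⟨⟨(NNReal.coe_nonneg _).trans_lt h, hu1⟩, fun j hj => hω j ?_⟩
          by_contra hj'
          have := (hlt (k + 1) j).2 (not_lt.1 hj')
          linarith
    have hdisj : Disjoint ((univ ×ˢ Ioc (0:ℝ) (tg n k)) ∩ s.Wn R n)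
          ((s.Bk R n (k + 1)) ×ˢ Ioc ((tg n k : ℝ≥0) : ℝ) (tg n (k + 1))) := by
      rw [Set.disjoint_left]
      rintro ⟨ω, u⟩ ⟨⟨_, h⟩, _⟩ ⟨_, h'⟩
      exact absurd h.2 (not_le.2 h'.1)
    rw [hset, setIntegral_union hdisj (hBm.prod measurableSet_Ioc)
      ((hHi' _ _ _).mono_set inter_subset_left) (hHi' _ _ _),
      setIntegral_prod _ (hHi' _ _ _)]
    have hmart := hM.setIntegral_eq hle hBm'
    have hI : ∀ a b : ℝ, Integrable (fun ω => ∫ u in Ioc a b, H (ω, u)) P :=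
      fun a b => (hHi a b).integral_prod_left
    have hsplit : ∀ ω, ∫ u in Ioc (0:ℝ) (tg n (k + 1)), H (ω, u) =
        (∫ u in Ioc (0:ℝ) (tg n k), H (ω, u)) +
          ∫ u in Ioc ((tg n k : ℝ≥0) : ℝ) (tg n (k + 1)), H (ω, u) := by
      intro ω
      have hi : ∀ a b : ℝ, IntegrableOn (fun u => H (ω, u)) (Ioc a b) := fun a b =>
        Integrable.of_bound (hHm.comp measurable_prodMk_left).aestronglyMeasurable B
          (Filter.Eventually.of_forall fun p => hB _ _)
      rw [← setIntegral_union (Ioc_disjoint_Ioc_of_le le_rfl) measurableSet_Ioc (hi _ _) (hi _ _),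
        Ioc_union_Ioc_eq_Ioc (NNReal.coe_nonneg _) hle']
    simp only [hsplit] at hmart
    have hFc : ∀ t, Integrable (fun ω => F (s.X t ω 0) - F (x 0)) P :=
      fun t => (hFi t).sub (integrable_const _)
    have hII : ∀ a b c d : ℝ, Integrable
        (fun ω => (∫ u in Ioc a b, H (ω, u)) + ∫ u in Ioc c d, H (ω, u)) P :=
      fun a b c d => (hI a b).add (hI c d)
    rw [integral_sub (hFc _).integrableOn (hI _ _).integrableOn,
      integral_sub (hFi _).integrableOn (integrable_const _).integrableOn,
      integral_sub (hFc _).integrableOn (hII _ _ _ _).integrableOn,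
      integral_sub (hFi _).integrableOn (integrable_const _).integrableOn,
      integral_add (hI _ _).integrableOn (hI _ _).integrableOn] at hmart
    have hmono : ∫ ω in s.Bk R n (k + 1), F (s.X (tg n k) ω 0) ∂P ≤
        ∫ ω in s.Bk R n k, F (s.X (tg n k) ω 0) ∂P := by
      refine setIntegral_mono_set (hFi _).integrableOn
        (Filter.Eventually.of_forall fun _ => hpos _) (LE.le.eventuallyLE ?_)
      intro ω hω j hj
      exact hω j (by omega)
    linarith

lemma occ (s : SJD 1 m Ω) {F : ℝ → ℝ} (hF : ContDiff ℝ 2 F) {C B R : ℝ}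
    (h0 : ∀ y, |F y| ≤ C) (h1 : ∀ y, |deriv F y| ≤ C) (h2 : ∀ y, |iteratedDeriv 2 F y| ≤ C)
    (hpos : ∀ y, 0 ≤ F y) (hB : ∀ x i, |s.G (fun y _ => F (y 0)) x i| ≤ B)
    {S : Set (Rd 1)} (hS : MeasurableSet S)
    (hG0 : ∀ y i, R ≤ ‖y‖ → s.G (fun y _ => F (y 0)) y i ≤ 0)
    (hG1 : ∀ y i, R ≤ ‖y‖ → y ∈ S → s.G (fun y _ => F (y 0)) y i ≤ -1)
    (x : Rd 1) (i : Fin m) (T : ℕ) :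
    ((s.P x i).prod volume)
      ((univ ×ˢ Ioc (0:ℝ) T) ∩ (s.Ws R ∩ {p | s.X p.2.toNNReal p.1 ∈ S})) ≤
      ENNReal.ofReal (F (x 0)) := by
  have := s.prob x i
  set P := s.P x i
  set H : Ω × ℝ → ℝ := fun p =>
    s.G (fun y _ => F (y 0)) (s.X p.2.toNNReal p.1) (s.Λ p.2.toNNReal p.1) with hH
  have hHm : Measurable H := s.H_meas hF
  set A : Set (Ω × ℝ) := univ ×ˢ Ioc (0:ℝ) T with hA
  have hAm : MeasurableSet A := MeasurableSet.univ.prod measurableSet_Ioc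
  have hAf : (P.prod volume) A < ⊤ := by
    rw [hA, Measure.prod_prod]; simp
  have : IsFiniteMeasure ((P.prod volume).restrict A) := ⟨by simpa using hAf⟩
  have hB0 : 0 ≤ B := (abs_nonneg _).trans (hB x i)
  have hn : ∀ n : ℕ, ∫ p in A, (s.Wn R n).indicator (fun p => - H p) p ∂(P.prod volume) ≤ F (x 0) := by
    intro n
    have h := s.occ_step (R := R) hF h0 h1 h2 hpos hB x i n (T * (n + 1))
    have e : ((tg n (T * (n + 1)) : ℝ≥0) : ℝ) = T := by
      rw [tg_coe]; push_cast
      have : ((n : ℝ) + 1) ≠ 0 := by positivity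
      field_simp
    have hp : 0 ≤ ∫ ω in s.Bk R n (T * (n + 1)), F (s.X (tg n (T * (n + 1))) ω 0) ∂(s.P x i) :=
      integral_nonneg fun ω => hpos _
    rw [e] at h
    rw [setIntegral_indicator (s.Wn_meas R n), integral_neg]
    linarith
  have hlim : Tendsto (fun n => ∫ p in A, (s.Wn R n).indicator (fun p => - H p) p ∂(P.prod volume))
      atTop (𝓝 (∫ p in A, (s.Ws R).indicator (fun p => - H p) p ∂(P.prod volume))) := by
    refine tendsto_integral_of_dominated_convergence (fun _ => B)
      (fun n => (hHm.neg.indicator (s.Wn_meas R n)).aestronglyMeasurable)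
      (integrable_const _) (fun n => Filter.Eventually.of_forall fun p => ?_)
      (Filter.Eventually.of_forall fun p => ?_)
    · refine (norm_indicator_le_norm_self _ _).trans ?_
      rw [norm_neg]; exact hB _ _
    · refine tendsto_const_nhds.congr' ?_
      by_cases hp : p ∈ s.Ws R
      · refine Filter.Eventually.of_forall fun n => ?_
        show _ = (s.Wn R n).indicator (fun p => - H p) p
        rw [indicator_of_mem hp, indicator_of_mem (mem_iInter.1 hp n)]
      · have : ∃ (t : ℝ≥0), (t : ℝ) < p.2 ∧ ‖s.X t p.1‖ < R := by
          simp only [Ws, mem_iInter, Wn, mem_ofPred_eq, not_forall, not_le] at hp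
          obtain ⟨n, j, h3, h4⟩ := hp
          exact ⟨_, h3, h4⟩
        obtain ⟨t, h3, h4⟩ := this
        filter_upwards [s.hit_ev h3 h4] with n hn'
        show _ = (s.Wn R n).indicator (fun p => - H p) p
        rw [indicator_of_notMem hp, indicator_of_notMem hn']
  have hW := le_of_tendsto' hlim hn
  set E := s.Ws R ∩ {p : Ω × ℝ | s.X p.2.toNNReal p.1 ∈ S} with hE
  have hEm : MeasurableSet E := (s.Ws_meas R).inter (s.Z_meas.fst hS)
  have hbad : ∀ᵐ p ∂(P.prod volume), ¬ (0 < p.2 ∧ p ∈ s.Ws R ∧ ‖s.X p.2.toNNReal p.1‖ < R) := by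
    refine (measure_eq_zero_iff_ae_notMem (s := {p : Ω × ℝ | 0 < p.2 ∧ p ∈ s.Ws R ∧ ‖s.X p.2.toNNReal p.1‖ < R})).1 ?_
    have hm : MeasurableSet {p : Ω × ℝ | 0 < p.2 ∧ p ∈ s.Ws R ∧ ‖s.X p.2.toNNReal p.1‖ < R} :=
      (measurableSet_lt measurable_const measurable_snd).inter
        ((s.Ws_meas R).inter (measurableSet_lt s.Z_meas.fst.norm measurable_const))
    rw [Measure.measure_prod_null hm]
    refine Filter.Eventually.of_forall fun ω => ?_
    apply Set.Subsingleton.measure_zero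
    have key : ∀ u v : ℝ, 0 < u → ‖s.X u.toNNReal ω‖ < R → (ω, v) ∈ s.Ws R → ¬ u < v := by
      intro u v hu hXu hv huv
      have := s.Ws_spec hv (t := u.toNNReal) (by rwa [Real.coe_toNNReal _ hu.le])
      linarith
    rintro u ⟨hu0, huW, huX⟩ v ⟨hv0, hvW, hvX⟩
    exact le_antisymm (not_lt.1 (key v u hv0 hvX huW)) (not_lt.1 (key u v hu0 huX hvW))
  have hfin : ∫ p in A, E.indicator (fun _ => (1:ℝ)) p ∂(P.prod volume) ≤
      ∫ p in A, (s.Ws R).indicator (fun p => - H p) p ∂(P.prod volume) := by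
    refine integral_mono_ae ((integrable_const _).indicator hEm) ?_ ?_
    · exact (Integrable.of_bound hHm.neg.aestronglyMeasurable B
        (Filter.Eventually.of_forall fun p => by
          simp only [Pi.neg_apply, norm_neg]; exact hB _ _)).indicator (s.Ws_meas R)
    · filter_upwards [ae_restrict_of_ae hbad, ae_restrict_mem hAm] with p hp hpA
      by_cases hpW : p ∈ s.Ws R
      · have hR : R ≤ ‖s.X p.2.toNNReal p.1‖ := by
          by_contra hcon
          exact hp ⟨hpA.2.1, hpW, not_le.1 hcon⟩
        rw [indicator_of_mem hpW]
        by_cases hpS : s.X p.2.toNNReal p.1 ∈ S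
        · rw [indicator_of_mem (show p ∈ E from ⟨hpW, hpS⟩)]
          have := hG1 _ (s.Λ p.2.toNNReal p.1) hR hpS
          simp only [hH]; linarith
        · rw [indicator_of_notMem (show p ∉ E from fun h => hpS h.2)]
          have := hG0 _ (s.Λ p.2.toNNReal p.1) hR
          simp only [hH]; linarith
      · rw [indicator_of_notMem hpW, indicator_of_notMem (show p ∉ E from fun h => hpW h.1)]
  rw [setIntegral_indicator hEm, setIntegral_const, smul_eq_mul, mul_one] at hfin
  rw [← ofReal_measureReal (ne_top_of_le_ne_top hAf.ne (measure_mono inter_subset_left))]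
  exact ENNReal.ofReal_le_ofReal (hfin.trans hW)

end SJD

namespace SJD
variable {m : ℕ} {Ω : Type} [MeasurableSpace Ω]

lemma sigma_le (s : SJD 1 m Ω) (R : ℝ) (ω : Ω) :
    s.sigmaZ (ball (0 : Rd 1) R ×ˢ (univ : Set (Fin m))) ω ≤
      volume (Prod.mk ω ⁻¹' ((univ ×ˢ Ioi (0:ℝ)) ∩ s.Ws R)) := by
  refine ENNReal.le_of_forall_nnreal_lt fun r hr => ?_
  have hsub : Ioc (0:ℝ) r ⊆ Prod.mk ω ⁻¹' ((univ ×ˢ Ioi (0:ℝ)) ∩ s.Ws R) := by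
    intro u hu
    refine ⟨⟨trivial, hu.1⟩, mem_iInter.2 fun n j hj => ?_⟩
    by_contra hc
    have hlt : tg n j < r := by
      rw [← NNReal.coe_lt_coe]; exact lt_of_lt_of_le hj hu.2
    have hle : s.sigmaZ (ball (0 : Rd 1) R ×ˢ (univ : Set (Fin m))) ω ≤ (tg n j : ℝ≥0) := by
      unfold sigmaZ hit
      refine iInf₂_le (tg n j) ⟨?_, trivial⟩
      simpa [Z] using hc
    have := hr.trans_le hle
    exact absurd (ENNReal.coe_lt_coe.1 this) (not_lt.2 hlt.le)
  refine le_trans ?_ (measure_mono hsub)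
  simp

lemma hfun_meas : Measurable fun y : Rd 1 => hfun (y 0) :=
  (hfun_contDiff.continuous.comp (EuclideanSpace.proj (𝕜 := ℝ) (0 : Fin 1)).continuous).measurable

lemma occ_all (s : SJD 1 m Ω)
    (hint : ∀ (x : Rd 1) (i : Fin m),
      (∫⁻ z in {z : Rd 1 | 1 ≤ ‖z‖}, ENNReal.ofReal (‖z‖ * s.pit x i z)) < ⊤)
    {K ε R : ℝ} (hK : 0 < K) (hKε : 1 ≤ K * ε) (hR : 2 ≤ R)
    (hl : ∀ x : Rd 1, R ≤ ‖x‖ → ∀ i,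
      (s.b x i 0 + ∫ z in {z : Rd 1 | 1 < ‖z‖ ∧ ‖z‖ ≤ ‖x‖}, z 0 * s.pit x i z) *
          Real.sign (x 0) +
        (∫ z in {z : Rd 1 | ‖x‖ < ‖z‖}, ‖z‖ * s.pit x i z) ≤ -ε)
    (x : Rd 1) (i : Fin m) :
    ((s.P x i).prod volume) ((univ ×ˢ Ioi (0:ℝ)) ∩ s.Ws R) ≤
      ENNReal.ofReal (K * hfun (x 0)) := by
  have hstep : ∀ N : ℕ, ((s.P x i).prod volume)
      ((univ ×ˢ Ioc (0:ℝ) N) ∩ (s.Ws R ∩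
        {p | s.X p.2.toNNReal p.1 ∈ {y : Rd 1 | K * hfun (y 0) ≤ (N : ℝ)}})) ≤
      ENNReal.ofReal (K * hfun (x 0)) := by
    intro N
    obtain ⟨C, L, hL, h0, h1, h2, hc⟩ := Fc_tr_bdd (K := K) (N := (N : ℝ)) hK
    have hF := Fc_contDiff (phitr_contDiff (N : ℝ)) K
    obtain ⟨B, hB⟩ := s.G_bdd hF h0 h1 h2 hL _ _
      (fun y hy => hc y (hy.trans_le (le_abs_self y)))
      (fun y hy => hc y (by have := neg_le_abs y; linarith))
    have hdr := s.drift hint hK hKε hR hl (phitr_contDiff (N : ℝ)) (phitr_deriv (N : ℝ))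
      (gtr_antitone (N : ℝ)) (gtr_nonneg (N : ℝ)) h1 h2
    have hnn : ∀ y, 0 ≤ K * hfun y := fun y => mul_nonneg hK.le (hfun_nonneg y)
    refine (s.occ (R := R) hF h0 h1 h2 (fun y => phitr_nonneg _ (hnn y)) hB
      (measurableSet_le (measurable_const.mul hfun_meas) measurable_const)
      (fun y j hy => (hdr y hy j).trans (neg_nonpos.2 (gtr_nonneg _ _)))
      (fun y j hy hyS => ?_) x i N).trans (ENNReal.ofReal_le_ofReal (phitr_le _ (hnn _)))
    have := hdr y hy j
    rwa [gtr_one (show K * hfun (y 0) ≤ (N : ℝ) from hyS)] at this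
  have hset : (univ ×ˢ Ioi (0:ℝ)) ∩ s.Ws R = ⋃ N : ℕ, ((univ ×ˢ Ioc (0:ℝ) N) ∩ (s.Ws R ∩
        {p | s.X p.2.toNNReal p.1 ∈ {y : Rd 1 | K * hfun (y 0) ≤ (N : ℝ)}})) := by
    ext ⟨ω, u⟩
    simp only [mem_inter_iff, mem_prod, mem_univ, true_and, mem_Ioi, mem_iUnion, mem_Ioc,
      mem_ofPred_eq]
    constructor
    · rintro ⟨hu, hW⟩
      obtain ⟨N, hN⟩ := exists_nat_ge (max u (K * hfun (s.X u.toNNReal ω 0)))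
      exact ⟨N, ⟨hu, (le_max_left _ _).trans hN⟩, hW, (le_max_right _ _).trans hN⟩
    · rintro ⟨N, ⟨hu, _⟩, hW, _⟩
      exact ⟨hu, hW⟩
  rw [hset, Monotone.measure_iUnion]
  · exact iSup_le hstep
  · rintro N N' hNN ⟨ω, u⟩ ⟨⟨h1, h2⟩, h3, h4⟩
    have hc : (N : ℝ) ≤ N' := by exact_mod_cast hNN
    exact ⟨⟨h1, h2.1, h2.2.trans hc⟩, h3, le_trans (show K * hfun _ ≤ (N : ℝ) from h4) hc⟩

end SJD

/-- **Example 5.2.** Let `d = 1`, suppose `G` is strictly irreducible on every bounded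
domain and `∫_{|z|≥1} |z| π̃_i(x,z)dz < ∞` for all `(x,i)`. With
`A(x,i) = b(x,i) + ∫_{1<|z|≤|x|} z π̃_i(x,z)dz` and `B(x,i) = ∫_{|z|>|x|} |z| π̃_i(x,z)dz`,
if `limsup_{|x|→∞} [A(x,i) sgn(x) + B(x,i)] < 0` for each `i`, then the process is
positive recurrent (condition (C1) holding with respect to some bounded domain times `M`). -/
theorem positive_recurrence_dim_one {m : ℕ} {Ω : Type} [MeasurableSpace Ω]
    (hm : 1 ≤ m) (s : SJD 1 m Ω)
    (hirr : s.StrictIrredAll)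
    (hint : ∀ (x : Rd 1) (i : Fin m),
      (∫⁻ z in {z : Rd 1 | 1 ≤ ‖z‖}, ENNReal.ofReal (‖z‖ * s.pit x i z)) < ⊤)
    (hlimsup : ∀ i : Fin m, ∃ ε > (0 : ℝ), ∃ R : ℝ, ∀ x : Rd 1, R ≤ ‖x‖ →
      (s.b x i 0 + ∫ z in {z : Rd 1 | 1 < ‖z‖ ∧ ‖z‖ ≤ ‖x‖}, z 0 * s.pit x i z) *
          Real.sign (x 0) +
        (∫ z in {z : Rd 1 | ‖x‖ < ‖z‖}, ‖z‖ * s.pit x i z) ≤ -ε) :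
    ∃ D : Set (Rd 1), BddDomain D ∧ s.C1 D ∧
      s.PosRecurrent (D ×ˢ (Set.univ : Set (Fin m))) := by
  obtain ⟨ε, hε, R, hR, hl⟩ : ∃ ε > (0:ℝ), ∃ R : ℝ, 2 ≤ R ∧ ∀ x : Rd 1, R ≤ ‖x‖ → ∀ i,
      (s.b x i 0 + ∫ z in {z : Rd 1 | 1 < ‖z‖ ∧ ‖z‖ ≤ ‖x‖}, z 0 * s.pit x i z) *
          Real.sign (x 0) +
        (∫ z in {z : Rd 1 | ‖x‖ < ‖z‖}, ‖z‖ * s.pit x i z) ≤ -ε := by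
    choose e he r hr using hlimsup
    have : Nonempty (Fin m) := ⟨⟨0, hm⟩⟩
    obtain ⟨i0, hi0⟩ := Finite.exists_min e
    obtain ⟨i1, hi1⟩ := Finite.exists_max r
    refine ⟨e i0, he i0, max 2 (r i1), le_max_left _ _, fun x hx i => ?_⟩
    refine (hr i x ((hi1 i).trans ((le_max_right _ _).trans hx))).trans ?_
    exact neg_le_neg (hi0 i)
  have hK : (0:ℝ) < 1 / ε := by positivity
  have hKε : 1 ≤ 1 / ε * ε := by rw [one_div, inv_mul_cancel₀ hε.ne']
  have hocc := s.occ_all hint hK hKε hR hl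
  have hlin : ∀ x i, ∫⁻ ω, volume (Prod.mk ω ⁻¹' ((univ ×ˢ Ioi (0:ℝ)) ∩ s.Ws R)) ∂(s.P x i)
      < ⊤ := by
    intro x i
    have := s.prob x i
    have hm : MeasurableSet ((univ ×ˢ Ioi (0:ℝ)) ∩ s.Ws R) :=
      (MeasurableSet.univ.prod measurableSet_Ioi).inter (s.Ws_meas R)
    rw [← Measure.prod_apply hm]
    exact (hocc x i).trans_lt ENNReal.ofReal_lt_top
  refine ⟨ball 0 R, ⟨isOpen_ball, ?_, isBounded_ball⟩, ?_, ?_, ?_⟩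
  · exact (convex_ball (0 : Rd 1) R).isConnected (nonempty_ball.2 (by linarith))
  · refine ⟨fun y _ => Fc id (1 / ε) (y 0), fun _ => lift_contDiff (Fc_contDiff contDiff_id _),
      fun x _ => mul_nonneg hK.le (hfun_nonneg _), fun x hx i => ?_⟩
    obtain ⟨C, h1, h2⟩ := SJD.Fc_id_bdd (1 / ε)
    exact s.drift hint hK hKε hR hl (φ := id) (g := fun _ => 1) contDiff_id
      (fun v => hasDerivAt_id v) antitone_const (fun _ => zero_le_one) h1 h2 x
      (by simpa using hx) i
  · intro x i _
    have := s.prob x i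
    have hm : MeasurableSet ((univ ×ˢ Ioi (0:ℝ)) ∩ s.Ws R) :=
      (MeasurableSet.univ.prod measurableSet_Ioi).inter (s.Ws_meas R)
    have hae := ae_lt_top (measurable_measure_prodMk_left (ν := (volume : Measure ℝ)) hm)
      (hlin x i).ne
    rw [measure_eq_measure_of_null_sdiff (subset_univ _), measure_univ]
    have h2 : ∀ᵐ ω ∂(s.P x i), s.sigmaZ (ball (0 : Rd 1) R ×ˢ (univ : Set (Fin m))) ω < ⊤ := by
      filter_upwards [hae] with ω hω
      exact (s.sigma_le R ω).trans_lt hω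
    rw [← compl_eq_univ_sdiff]
    exact h2
  · intro x i _
    exact (lintegral_mono (s.sigma_le R)).trans_lt (hlin x i)
end
end
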